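/- For each integer k ≥ 0 there exists α > 0 such that the solution of the IVP with initial value α is decaying and has exactly k zeros in (0,∞). -/

import Mathlib

open Real Filter Set

/-- The nonlinearity `f(s) = -s + |s|^(p-1) s`. -/
noncomputable def f (p s : ℝ) : ℝ := -s + |s| ^ (p - 1) * s

/-- The derivative of the nonlinearity, `f'(s) = -1 + p |s|^(p-1)`. -/
noncomputable def fder (p s : ℝ) : ℝ := -1 + p * |s| ^ (p - 1)

/-- The primitive `F(s) = -s^2/2 + |s|^(p+1)/(p+1)`. -/
noncomputable def F (p s : ℝ) : ℝ := -s ^ 2 / 2 + |s| ^ (p + 1) / (p + 1)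

/-- `u : [0,∞) → ℝ` (modeled on `Set.Ici 0`) is a C² solution of the IVP
`u'' + ((n-1)/r) u' + f(u) = 0`, `u(0) = α`, `u'(0) = 0`; the data `u'`, `u''`
are its first and second derivatives on `[0,∞)`. -/
structure IsSolution (n : ℕ) (p α : ℝ) (u u' u'' : ℝ → ℝ) : Prop where
  init : u 0 = α
  initDeriv : u' 0 = 0
  hasDeriv1 : ∀ r ∈ Set.Ici (0:ℝ), HasDerivWithinAt u (u' r) (Set.Ici 0) r
  hasDeriv2 : ∀ r ∈ Set.Ici (0:ℝ), HasDerivWithinAt u' (u'' r) (Set.Ici 0) r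
  cont2 : ContinuousOn u'' (Set.Ici 0)
  ode : ∀ r : ℝ, 0 < r → u'' r + ((n : ℝ) - 1) / r * u' r + f p (u r) = 0

/-- The variation `v` associated with a solution `u`: the C² solution of the linearized
equation `v'' + ((n-1)/r) v' + f'(u) v = 0`, `v(0) = 1`, `v'(0) = 0`. -/
structure IsVariation (n : ℕ) (p : ℝ) (u v v' v'' : ℝ → ℝ) : Prop where
  init : v 0 = 1
  initDeriv : v' 0 = 0
  hasDeriv1 : ∀ r ∈ Set.Ici (0:ℝ), HasDerivWithinAt v (v' r) (Set.Ici 0) r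
  hasDeriv2 : ∀ r ∈ Set.Ici (0:ℝ), HasDerivWithinAt v' (v'' r) (Set.Ici 0) r
  cont2 : ContinuousOn v'' (Set.Ici 0)
  ode : ∀ r : ℝ, 0 < r → v'' r + ((n : ℝ) - 1) / r * v' r + fder p (u r) * v r = 0

/-- `u` is decaying: `u(r) → 0` and `u'(r) → 0` as `r → ∞`. -/
def Decaying (u u' : ℝ → ℝ) : Prop :=
  Filter.Tendsto u Filter.atTop (nhds 0) ∧ Filter.Tendsto u' Filter.atTop (nhds 0)

/-- `u` changes sign on `(0,∞)`. -/
def ChangesSign (u : ℝ → ℝ) : Prop :=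
  (∃ r : ℝ, 0 < r ∧ u r < 0) ∧ (∃ r : ℝ, 0 < r ∧ 0 < u r)

/-- `z 0 < z 1 < ⋯ < z (k-1)` are exactly the zeros of `u` in `(0,∞)`. -/
def ExactZeros (u : ℝ → ℝ) (k : ℕ) (z : Fin k → ℝ) : Prop :=
  StrictMono z ∧ (∀ i, 0 < z i ∧ u (z i) = 0) ∧
    ∀ r : ℝ, 0 < r → u r = 0 → ∃ i, r = z i

namespace RadialBoundState

/-- The odd power `|s|^(p-1) s`. -/
noncomputable def oddPow (p s : ℝ) : ℝ := |s| ^ (p - 1) * s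

/-- Truncation of a real number to `[-1, 1]`. -/
noncomputable def clip (s : ℝ) : ℝ := max (min s 1) (-1)

/-- The nonlinearity `|s|^(p-1) s - c s`, truncated outside `[-1, 1]`. -/
noncomputable def truncNonlin (p c s : ℝ) : ℝ := oddPow p (clip s) - c * clip s

lemma oddPow_neg (p s : ℝ) : oddPow p (-s) = -oddPow p s := by simp [oddPow]

lemma oddPow_of_nonneg {p s : ℝ} (hp : 1 < p) (hs : 0 ≤ s) : oddPow p s = s ^ p := by
  rw [oddPow, abs_of_nonneg hs]
  rcases hs.eq_or_lt with rfl | h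
  · simp [Real.zero_rpow (by linarith : p ≠ 0)]
  · rw [← Real.rpow_add_one h.ne']; simp

lemma continuous_oddPow {p : ℝ} (hp : 1 < p) : Continuous (oddPow p) :=
  (continuous_abs.rpow_const fun _ => Or.inr (by linarith)).mul continuous_id

lemma oddPow_mul_self {p : ℝ} (hp : 1 < p) (s : ℝ) : oddPow p s * s = |s| ^ (p + 1) := by
  rcases eq_or_ne s 0 with rfl | h
  · simp [Real.zero_rpow (by linarith : p + 1 ≠ 0)]
  · have : |s| ^ (p + 1) = |s| ^ (p - 1) * |s| ^ (2 : ℝ) := by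
      rw [← Real.rpow_add (abs_pos.mpr h)]; ring_nf
    rw [this, oddPow, Real.rpow_two, sq_abs]; ring

lemma abs_oddPow_sub_le_of_nonneg {p a b : ℝ} (hp : 1 < p) (ha : a ∈ Icc (0:ℝ) 1)
    (hb : b ∈ Icc (0:ℝ) 1) : |oddPow p a - oddPow p b| ≤ p * |a - b| := by
  rw [oddPow_of_nonneg hp ha.1, oddPow_of_nonneg hp hb.1]
  have := Convex.norm_image_sub_le_of_norm_hasDerivWithin_le (f := fun x : ℝ => x ^ p)
    (f' := fun x => p * x ^ (p - 1)) (s := Icc (0:ℝ) 1) (C := p) (x := b) (y := a)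
    (fun x _ => (Real.hasDerivAt_rpow_const (Or.inr hp.le)).hasDerivWithinAt) ?_
    (convex_Icc 0 1) hb ha
  · simpa using this
  · intro x hx
    have h1 : x ^ (p - 1) ≤ 1 := Real.rpow_le_one hx.1 hx.2 (by linarith)
    have h0 : 0 ≤ x ^ (p - 1) := Real.rpow_nonneg hx.1 _
    rw [Real.norm_eq_abs, abs_of_nonneg (by positivity)]
    nlinarith

lemma abs_oddPow_sub_le {p a b : ℝ} (hp : 1 < p) (ha : |a| ≤ 1) (hb : |b| ≤ 1) :
    |oddPow p a - oddPow p b| ≤ p * |a - b| := by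
  rw [abs_le] at ha hb
  have zero : oddPow p 0 = 0 := by simp [oddPow]
  have mixed : ∀ x y : ℝ, x ∈ Icc (0:ℝ) 1 → y ∈ Icc (0:ℝ) 1 →
      |oddPow p x - oddPow p (-y)| ≤ p * |x - -y| := by
    intro x y hx hy
    have h1 := abs_oddPow_sub_le_of_nonneg hp hx (left_mem_Icc.2 zero_le_one)
    have h2 := abs_oddPow_sub_le_of_nonneg hp hy (left_mem_Icc.2 zero_le_one)
    rw [zero, sub_zero, sub_zero, abs_of_nonneg hx.1] at h1
    rw [zero, sub_zero, sub_zero, abs_of_nonneg hy.1] at h2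
    rw [oddPow_neg, sub_neg_eq_add, sub_neg_eq_add, abs_of_nonneg (add_nonneg hx.1 hy.1)]
    calc _ ≤ |oddPow p x| + |oddPow p y| := abs_add_le _ _
      _ ≤ _ := by linarith
  rcases le_total 0 a with h1 | h1 <;> rcases le_total 0 b with h2 | h2
  · exact abs_oddPow_sub_le_of_nonneg hp ⟨h1, ha.2⟩ ⟨h2, hb.2⟩
  · simpa using mixed a (-b) ⟨h1, ha.2⟩ ⟨by linarith, by linarith⟩
  · simpa [abs_sub_comm] using mixed b (-a) ⟨h2, hb.2⟩ ⟨by linarith, by linarith⟩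
  · have := abs_oddPow_sub_le_of_nonneg (a := -a) (b := -b) hp ⟨by linarith, by linarith⟩
      ⟨by linarith, by linarith⟩
    rw [oddPow_neg, oddPow_neg, ← neg_sub', abs_neg, ← neg_sub', abs_neg] at this
    exact this

lemma abs_clip_le (s : ℝ) : |clip s| ≤ 1 :=
  abs_le.2 ⟨le_max_right _ _, max_le (min_le_right _ _) (by norm_num)⟩

lemma clip_of_abs_le {s : ℝ} (h : |s| ≤ 1) : clip s = s := by
  rw [abs_le] at h
  rw [clip, min_eq_left h.2, max_eq_left h.1]

lemma clip_neg (s : ℝ) : clip (-s) = -clip s := by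
  unfold clip
  rcases le_total s 1 with h | h <;> rcases le_total (-1) s with h' | h'
  · rw [min_eq_left h, max_eq_left h', min_eq_left (by linarith), max_eq_left (by linarith)]
  · rw [min_eq_left h, max_eq_right h', min_eq_right (by linarith), max_eq_left (by linarith)]
    simp
  · rw [min_eq_left (by linarith), max_eq_right (by linarith), min_eq_right h,
      max_eq_left (by norm_num)]
  · linarith

lemma clip_of_one_le {s : ℝ} (h : 1 ≤ s) : clip s = 1 := by
  rw [clip, min_eq_right h, max_eq_left (by norm_num)]

lemma abs_clip_sub_le (a b : ℝ) : |clip a - clip b| ≤ |a - b| :=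
  (abs_max_sub_max_le_abs _ _ _).trans
    ((abs_min_sub_min_le_max _ _ _ _).trans (max_le le_rfl (by simp)))

lemma continuous_truncNonlin {p : ℝ} (hp : 1 < p) (c : ℝ) : Continuous (truncNonlin p c) := by
  have h : Continuous clip := by unfold clip; fun_prop
  exact ((continuous_oddPow hp).comp h).sub (continuous_const.mul h)

lemma abs_truncNonlin_sub_le {p c : ℝ} (hp : 1 < p) (hc : c ∈ Icc (0:ℝ) 1) (a b : ℝ) :
    |truncNonlin p c a - truncNonlin p c b| ≤ (p + 1) * |a - b| := by
  have h1 := abs_oddPow_sub_le hp (abs_clip_le a) (abs_clip_le b)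
  have h2 := abs_clip_sub_le a b
  have h3 : |c * (clip a - clip b)| ≤ |clip a - clip b| := by
    rw [abs_mul, abs_of_nonneg hc.1]
    exact mul_le_of_le_one_left (abs_nonneg _) hc.2
  calc |truncNonlin p c a - truncNonlin p c b|
      = |(oddPow p (clip a) - oddPow p (clip b)) - c * (clip a - clip b)| := by
        unfold truncNonlin; ring_nf
    _ ≤ |oddPow p (clip a) - oddPow p (clip b)| + |c * (clip a - clip b)| := abs_sub _ _
    _ ≤ (p + 1) * |a - b| := by nlinarith

lemma truncNonlin_zero (p c : ℝ) : truncNonlin p c 0 = 0 := by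
  simp [truncNonlin, clip_of_abs_le, oddPow]

lemma truncNonlin_neg (p c s : ℝ) : truncNonlin p c (-s) = -truncNonlin p c s := by
  simp only [truncNonlin, clip_neg, oddPow_neg]; ring

lemma abs_truncNonlin_sub_param_le (p c d s : ℝ) :
    |truncNonlin p c s - truncNonlin p d s| ≤ |c - d| := by
  have : truncNonlin p c s - truncNonlin p d s = -(c - d) * clip s := by
    unfold truncNonlin; ring
  rw [this, abs_mul, abs_neg]
  exact mul_le_of_le_one_right (abs_nonneg _) (abs_clip_le s)

/-- The weighted average `∫₀¹ σ^(n-1) φ(s σ) dσ`. -/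
noncomputable def radialAvg (n : ℕ) (φ : ℝ → ℝ) (s : ℝ) : ℝ :=
  ∫ σ in (0:ℝ)..1, σ ^ (n - 1) * φ (s * σ)

lemma continuous_radialAvg (n : ℕ) {φ : ℝ → ℝ} (hφ : Continuous φ) :
    Continuous (radialAvg n φ) := by
  unfold radialAvg
  apply intervalIntegral.continuous_parametric_intervalIntegral_of_continuous'
  simp only [Function.uncurry_def]
  fun_prop

lemma radialAvg_zero {n : ℕ} (hn : 1 ≤ n) (φ : ℝ → ℝ) : n * radialAvg n φ 0 = φ 0 := by
  have hn' : (n : ℝ) ≠ 0 := by positivity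
  have : ((n - 1 : ℕ) : ℝ) + 1 = n := by
    rw [Nat.cast_sub hn]; simp
  simp only [radialAvg, zero_mul, intervalIntegral.integral_mul_const, integral_pow, this]
  rw [Nat.sub_add_cancel hn]
  field_simp
  simp [show n ≠ 0 by omega]

lemma radialAvg_sub (n : ℕ) {φ ψ : ℝ → ℝ} (hφ : Continuous φ) (hψ : Continuous ψ) (s : ℝ) :
    radialAvg n φ s - radialAvg n ψ s = radialAvg n (fun t => φ t - ψ t) s := by
  unfold radialAvg
  rw [← intervalIntegral.integral_sub]
  · simp only [mul_sub]
  · exact (by fun_prop : Continuous _).intervalIntegrable _ _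
  · exact (by fun_prop : Continuous _).intervalIntegrable _ _

lemma integral_exp_mul_le {K : ℝ} (hK : 0 < K) {B : ℝ} (hB : 0 ≤ B) (r : ℝ) :
    ∫ s in (0:ℝ)..r, B * exp (K * s) ≤ B / K * exp (K * r) := by
  have h : ∀ x ∈ uIcc 0 r, HasDerivAt (fun x => B / K * exp (K * x)) (B * exp (K * x)) x := by
    intro x _
    have := (((hasDerivAt_id x).const_mul K).exp).const_mul (B / K)
    refine this.congr_deriv ?_
    simp only [id]; field_simp
  rw [intervalIntegral.integral_eq_sub_of_hasDerivAt h
    ((by fun_prop : Continuous _).intervalIntegrable _ _)]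
  have : 0 ≤ B / K * exp (K * 0) := by positivity
  linarith

lemma abs_mul_radialAvg_le {n : ℕ} {φ : ℝ → ℝ} {K B s : ℝ} (hK : 0 < K)
    (hB : 0 ≤ B) (hs : 0 ≤ s) (h : ∀ t, 0 ≤ t → |φ t| ≤ B * exp (K * t)) :
    |s * radialAvg n φ s| ≤ B / K * exp (K * s) := by
  have h1 : ‖∫ σ in (0:ℝ)..1, σ ^ (n - 1) * φ (s * σ)‖ ≤
      ∫ σ in (0:ℝ)..1, B * exp (K * (s * σ)) := by
    apply intervalIntegral.norm_integral_le_of_norm_le zero_le_one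
    · refine Eventually.of_forall fun σ hσ => ?_
      have := h (s * σ) (mul_nonneg hs hσ.1.le)
      rw [norm_mul, norm_pow, Real.norm_eq_abs, Real.norm_eq_abs, abs_of_pos hσ.1]
      calc σ ^ (n - 1) * |φ (s * σ)| ≤ 1 * |φ (s * σ)| := by
            gcongr; exact pow_le_one₀ hσ.1.le hσ.2
        _ ≤ _ := by rwa [one_mul]
    · exact (by fun_prop : Continuous _).intervalIntegrable _ _
  have h2 := intervalIntegral.smul_integral_comp_mul_left (a := 0) (b := 1)
    (fun t => B * exp (K * t)) s
  have h3 := integral_exp_mul_le hK hB s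
  rw [abs_mul, abs_of_nonneg hs]
  simp only [smul_eq_mul, mul_zero, mul_one] at h2
  calc s * |radialAvg n φ s| ≤ s * ∫ σ in (0:ℝ)..1, B * exp (K * (s * σ)) :=
        mul_le_mul_of_nonneg_left h1 hs
    _ ≤ _ := by rw [h2]; exact h3

lemma abs_integral_mul_radialAvg_le {n : ℕ} {φ : ℝ → ℝ} {K B r : ℝ}
    (hK : 0 < K) (hB : 0 ≤ B) (hr : 0 ≤ r) (h : ∀ t, 0 ≤ t → |φ t| ≤ B * exp (K * t)) :
    |∫ s in (0:ℝ)..r, s * radialAvg n φ s| ≤ B / K ^ 2 * exp (K * r) := by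
  have h1 : ‖∫ s in (0:ℝ)..r, s * radialAvg n φ s‖ ≤ ∫ s in (0:ℝ)..r, B / K * exp (K * s) := by
    apply intervalIntegral.norm_integral_le_of_norm_le hr
    · exact Eventually.of_forall fun s hs => abs_mul_radialAvg_le hK hB hs.1.le h
    · exact (by fun_prop : Continuous _).intervalIntegrable _ _
  have h2 := integral_exp_mul_le hK (div_nonneg hB hK.le) r
  calc _ ≤ _ := h1
    _ ≤ _ := h2
    _ = _ := by rw [div_div, sq]

lemma hasDerivAt_mul_radialAvg {n : ℕ} (hn : 2 ≤ n) {φ : ℝ → ℝ} (hφ : Continuous φ) {r : ℝ}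
    (hr : 0 < r) : HasDerivAt (fun s => s * radialAvg n φ s)
      (φ r - ((n : ℝ) - 1) * radialAvg n φ r) r := by
  obtain ⟨m, rfl⟩ : ∃ m, n = m + 2 := ⟨n - 2, by omega⟩
  set I : ℝ → ℝ := fun s => ∫ t in (0:ℝ)..s, t ^ (m + 1) * φ t with hI
  have key : ∀ s, 0 < s → radialAvg (m + 2) φ s = I s / s ^ (m + 2) := by
    intro s hs
    have h2 := intervalIntegral.smul_integral_comp_mul_left (a := 0) (b := 1)
      (fun t => t ^ (m + 1) * φ t) s
    simp only [smul_eq_mul, mul_zero, mul_one, mul_pow, mul_assoc,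
      intervalIntegral.integral_const_mul] at h2
    rw [show I s = _ from h2.symm]
    simp only [radialAvg, show m + 2 - 1 = m + 1 by omega]
    field_simp
    ring
  have hd : HasDerivAt I (r ^ (m + 1) * φ r) r :=
    intervalIntegral.integral_hasDerivAt_right
      ((by fun_prop : Continuous fun t => t ^ (m + 1) * φ t).intervalIntegrable _ _)
      ((by fun_prop : Continuous fun t => t ^ (m + 1) * φ t).stronglyMeasurableAtFilter _ _)
      (by fun_prop : Continuous fun t => t ^ (m + 1) * φ t).continuousAt
  have h3 := hd.div (hasDerivAt_pow (m + 1) r) (pow_ne_zero _ hr.ne')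
  refine (h3.congr_deriv ?_).congr_of_eventuallyEq ?_
  · rw [key r hr]
    push_cast
    field_simp
    ring
  · filter_upwards [lt_mem_nhds hr] with s hs
    rw [key s hs, Pi.div_apply]
    field_simp
    ring

/-- The integrand of the integral equation for `w = exp (K |·|) y`. -/
noncomputable def picardSource (p K c : ℝ) (y : ℝ → ℝ) (t : ℝ) : ℝ :=
  truncNonlin p c (exp (K * |t|) * y t)

lemma continuous_picardSource {p : ℝ} (hp : 1 < p) (K c : ℝ) {y : ℝ → ℝ} (hy : Continuous y) :
    Continuous (picardSource p K c y) :=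
  (continuous_truncNonlin hp c).comp (by fun_prop)

lemma abs_picardSource_sub_le {p K c : ℝ} (hp : 1 < p) (hc : c ∈ Icc (0:ℝ) 1)
    (y z : BoundedContinuousFunction ℝ ℝ) {t : ℝ} (ht : 0 ≤ t) :
    |picardSource p K c y t - picardSource p K c z t| ≤ (p + 1) * dist y z * exp (K * t) := by
  refine (abs_truncNonlin_sub_le hp hc _ _).trans ?_
  rw [abs_of_nonneg ht, ← mul_sub, abs_mul, abs_of_pos (exp_pos _), mul_assoc, mul_comm (dist y z)]
  have := BoundedContinuousFunction.dist_coe_le_dist (f := y) (g := z) t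
  rw [Real.dist_eq] at this
  gcongr

lemma abs_picardSource_le {p K c : ℝ} (hp : 1 < p) (hc : c ∈ Icc (0:ℝ) 1)
    (y : BoundedContinuousFunction ℝ ℝ) {t : ℝ} (ht : 0 ≤ t) :
    |picardSource p K c y t| ≤ (p + 1) * dist y 0 * exp (K * t) := by
  simpa [picardSource, truncNonlin_zero] using abs_picardSource_sub_le (K := K) hp hc y 0 ht

/-- The unweighted Picard iterate `1 - ∫₀ʳ s · radialAvg (picardSource y) s ds`. -/
noncomputable def picardMap (n : ℕ) (p K c : ℝ) (y : ℝ → ℝ) (r : ℝ) : ℝ :=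
  1 - ∫ s in (0:ℝ)..r, s * radialAvg n (picardSource p K c y) s

lemma hasDerivAt_picardMap (n : ℕ) {p : ℝ} (hp : 1 < p) (K c : ℝ) {y : ℝ → ℝ}
    (hy : Continuous y) (r : ℝ) :
    HasDerivAt (picardMap n p K c y) (-r * radialAvg n (picardSource p K c y) r) r := by
  have hc : Continuous fun s => s * radialAvg n (picardSource p K c y) s :=
    continuous_id.mul (continuous_radialAvg n (continuous_picardSource hp K c hy))
  have := (intervalIntegral.integral_hasDerivAt_right (hc.intervalIntegrable 0 r)
    (hc.stronglyMeasurableAtFilter _ _) hc.continuousAt).const_sub 1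
  exact this.congr_deriv (by ring)

lemma abs_picardMap_sub_le {n : ℕ} {p K c d B : ℝ} (hp : 1 < p) (hK : 0 < K) (hB : 0 ≤ B)
    {y z : ℝ → ℝ} (hy : Continuous y) (hz : Continuous z)
    (h : ∀ t, 0 ≤ t → |picardSource p K c y t - picardSource p K d z t| ≤ B * exp (K * t))
    {r : ℝ} (hr : 0 ≤ r) :
    |picardMap n p K c y r - picardMap n p K d z r| ≤ B / K ^ 2 * exp (K * r) := by
  have hcy := continuous_picardSource hp K c hy
  have hcz := continuous_picardSource hp K d hz
  have e : picardMap n p K c y r - picardMap n p K d z r = -∫ s in (0:ℝ)..r,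
      s * radialAvg n (fun t => picardSource p K c y t - picardSource p K d z t) s := by
    simp only [picardMap, ← radialAvg_sub n hcy hcz, mul_sub]
    rw [intervalIntegral.integral_sub]
    · ring
    · exact (continuous_id.mul (continuous_radialAvg n hcy)).intervalIntegrable _ _
    · exact (continuous_id.mul (continuous_radialAvg n hcz)).intervalIntegrable _ _
  rw [e, abs_neg]
  exact abs_integral_mul_radialAvg_le hK hB hr h

lemma abs_picardMap_sub_one_le {n : ℕ} {p K c : ℝ} (hp : 1 < p) (hK : 0 < K)
    (hc : c ∈ Icc (0:ℝ) 1) (y : BoundedContinuousFunction ℝ ℝ) {r : ℝ} (hr : 0 ≤ r) :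
    |picardMap n p K c y r - 1| ≤ (p + 1) * dist y 0 / K ^ 2 * exp (K * r) := by
  rw [picardMap, sub_sub_cancel_left, abs_neg]
  exact abs_integral_mul_radialAvg_le hK (by positivity) hr
    fun t ht => abs_picardSource_le hp hc y ht

/-- The weighted Picard operator on bounded continuous functions. -/
noncomputable def picardOp (n : ℕ) {p K c : ℝ} (hp : 1 < p) (hK : 0 < K)
    (hc : c ∈ Icc (0:ℝ) 1) (y : BoundedContinuousFunction ℝ ℝ) :
    BoundedContinuousFunction ℝ ℝ :=
  BoundedContinuousFunction.ofNormedAddCommGroup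
    (fun r => exp (-(K * |r|)) * picardMap n p K c y |r|)
    (by
      have : Continuous (picardMap n p K c y) :=
        continuous_iff_continuousAt.2 fun r =>
          (hasDerivAt_picardMap n hp K c y.continuous r).continuousAt
      fun_prop)
    (1 + (p + 1) * dist y 0 / K ^ 2)
    (by
      intro r
      have h := abs_picardMap_sub_one_le (n := n) hp hK hc y (abs_nonneg r)
      have h1 : |(picardMap n p K c y |r|)| ≤ (1 + (p + 1) * dist y 0 / K ^ 2) * exp (K * |r|) := by
        have h2 : 1 ≤ exp (K * |r|) := Real.one_le_exp (by positivity)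
        have h3 := abs_add_le (picardMap n p K c y |r| - 1) 1
        rw [sub_add_cancel, abs_one] at h3
        linarith
      rw [norm_mul, Real.norm_eq_abs, Real.norm_eq_abs, abs_of_pos (exp_pos _), exp_neg]
      rw [inv_mul_le_iff₀ (exp_pos _)]
      linarith)

lemma dist_picardOp_le {n : ℕ} {p K c d B : ℝ} (hp : 1 < p) (hK : 0 < K)
    (hc : c ∈ Icc (0:ℝ) 1) (hd : d ∈ Icc (0:ℝ) 1) (hB : 0 ≤ B)
    (y z : BoundedContinuousFunction ℝ ℝ)
    (h : ∀ t, 0 ≤ t → |picardSource p K c y t - picardSource p K d z t| ≤ B * exp (K * t)) :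
    dist (picardOp n hp hK hc y) (picardOp n hp hK hd z) ≤ B / K ^ 2 := by
  rw [BoundedContinuousFunction.dist_le (by positivity)]
  intro r
  have := abs_picardMap_sub_le (n := n) hp hK hB y.continuous z.continuous h (abs_nonneg r)
  change dist (exp (-(K * |r|)) * picardMap n p K c y |r|)
    (exp (-(K * |r|)) * picardMap n p K d z |r|) ≤ _
  rw [Real.dist_eq, ← mul_sub, abs_mul, abs_of_pos (exp_pos _), exp_neg,
    inv_mul_le_iff₀ (exp_pos _)]
  linarith

lemma contractingWith_picardOp (n : ℕ) {p c : ℝ} (hp : 1 < p) (hc : c ∈ Icc (0:ℝ) 1)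
    (hK : 0 < p + 1) : ContractingWith (1 / 2) (picardOp n hp hK hc) := by
  refine ⟨by norm_num, LipschitzWith.of_dist_le_mul fun y z => ?_⟩
  refine (dist_picardOp_le hp hK hc hc (by positivity) y z
    fun t ht => abs_picardSource_sub_le hp hc y z ht).trans ?_
  have : (p + 1) * dist y z / (p + 1) ^ 2 = 1 / (p + 1) * dist y z := by field_simp
  rw [this]
  push_cast
  gcongr
  linarith

/-- A pair `(w, v)` with `w' = v` solving
`v' + (n-1)/r v + |w|^(p-1) w - c w = 0` with the nonlinearity truncated,
`w 0 = 1` and `v r = - r J r` for a continuous `J`. -/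
structure IsTruncProfile (n : ℕ) (p c : ℝ) (w v J : ℝ → ℝ) : Prop where
  init : w 0 = 1
  deriv_w : ∀ r, HasDerivAt w (v r) r
  v_eq : ∀ r, v r = -r * J r
  cont_J : Continuous J
  J_zero : n * J 0 = truncNonlin p c (w 0)
  deriv_v : ∀ r, 0 < r → HasDerivAt v (((n : ℝ) - 1) * J r - truncNonlin p c (w r)) r

lemma exists_truncProfile_family {n : ℕ} (hn : 2 ≤ n) {p : ℝ} (hp : 1 < p) :
    ∃ w v J : ℝ → ℝ → ℝ, (∀ c ∈ Icc (0:ℝ) 1, IsTruncProfile n p c (w c) (v c) (J c)) ∧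
      ∀ c ∈ Icc (0:ℝ) 1, ∀ d ∈ Icc (0:ℝ) 1, ∀ r, 0 ≤ r →
        |w c r - w d r| ≤ |c - d| * exp ((p + 1) * r) ∧
        |v c r - v d r| ≤ 2 * |c - d| * exp ((p + 1) * r) := by
  have hK : 0 < p + 1 := by linarith
  have hfix : ∀ c (hc : c ∈ Icc (0:ℝ) 1), ∃ y : BoundedContinuousFunction ℝ ℝ,
      picardOp n hp hK hc y = y := fun c hc =>
    ⟨_, (contractingWith_picardOp n hp hc hK).fixedPoint_isFixedPt⟩
  choose! y hy using hfix
  have hyr : ∀ c ∈ Icc (0:ℝ) 1, ∀ r, 0 ≤ r →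
      exp ((p + 1) * r) * y c r = picardMap n p (p + 1) c (y c) r := by
    intro c hc r hr
    have h : exp (-((p + 1) * |r|)) * picardMap n p (p + 1) c (y c) |r| = y c r :=
      congrArg (fun z : BoundedContinuousFunction ℝ ℝ => z r) (hy c hc)
    rw [abs_of_nonneg hr] at h
    rw [← h, ← mul_assoc, ← exp_add]
    simp
  have hdist : ∀ c ∈ Icc (0:ℝ) 1, ∀ d ∈ Icc (0:ℝ) 1, dist (y c) (y d) ≤ |c - d| := by
    intro c hc d hd
    have h1 : dist (y c) (y d) ≤ (|c - d| / (p + 1) ^ 2) / (1 - ((1 / 2 : NNReal) : ℝ)) := by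
      refine (contractingWith_picardOp n hp hc hK).dist_fixedPoint_fixedPoint_of_dist_le'
        (picardOp n hp hK hd) (hy c hc) (hy d hd) fun z =>
        dist_picardOp_le hp hK hc hd (abs_nonneg _) z z fun t ht => ?_
      refine (abs_truncNonlin_sub_param_le _ _ _ _).trans
        (le_mul_of_one_le_right (abs_nonneg _) (one_le_exp (by positivity)))
    refine h1.trans ?_
    have : |c - d| / (p + 1) ^ 2 / (1 - ((1 / 2 : NNReal) : ℝ)) = |c - d| * (2 / (p + 1) ^ 2) := by
      push_cast; ring
    rw [this]
    refine mul_le_of_le_one_right (abs_nonneg _) ?_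
    rw [div_le_one (by positivity)]
    nlinarith
  have hsrc : ∀ c ∈ Icc (0:ℝ) 1, ∀ d ∈ Icc (0:ℝ) 1, ∀ t, 0 ≤ t →
      |picardSource p (p + 1) c (y c) t - picardSource p (p + 1) d (y d) t| ≤
        (p + 2) * |c - d| * exp ((p + 1) * t) := by
    intro c hc d hd t ht
    have h1 := abs_picardSource_sub_le (K := p + 1) hp hc (y c) (y d) ht
    have h2 : |picardSource p (p + 1) c (y d) t - picardSource p (p + 1) d (y d) t| ≤
        |c - d| * exp ((p + 1) * t) :=
      (abs_truncNonlin_sub_param_le _ _ _ _).trans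
        (le_mul_of_one_le_right (abs_nonneg _) (one_le_exp (by positivity)))
    have h3 : (p + 1) * dist (y c) (y d) * exp ((p + 1) * t) ≤
        (p + 1) * |c - d| * exp ((p + 1) * t) := by
      gcongr; exact hdist c hc d hd
    have h4 := abs_sub_le (picardSource p (p + 1) c (y c) t)
      (picardSource p (p + 1) c (y d) t) (picardSource p (p + 1) d (y d) t)
    nlinarith
  have hcs : ∀ c, Continuous (picardSource p (p + 1) c (y c)) := fun c =>
    continuous_picardSource hp _ _ (y c).continuous
  refine ⟨fun c => picardMap n p (p + 1) c (y c),
    fun c r => -r * radialAvg n (picardSource p (p + 1) c (y c)) r,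
    fun c => radialAvg n (picardSource p (p + 1) c (y c)), fun c hc => ?_, ?_⟩
  · have hw : ∀ r, 0 ≤ r → picardSource p (p + 1) c (y c) r =
        truncNonlin p c (picardMap n p (p + 1) c (y c) r) := by
      intro r hr
      rw [← hyr c hc r hr, picardSource, abs_of_nonneg hr]
    refine ⟨by simp [picardMap], hasDerivAt_picardMap n hp _ c (y c).continuous, fun r => rfl,
      continuous_radialAvg n (hcs c), ?_, fun r hr => ?_⟩
    · rw [radialAvg_zero (by omega), hw 0 le_rfl]
    · have h := (hasDerivAt_mul_radialAvg hn (hcs c) hr).neg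
      rw [hw r hr.le] at h
      simp only [neg_mul]
      exact h.congr_deriv (by ring)
  · intro c hc d hd r hr
    constructor
    · change |picardMap n p (p + 1) c (y c) r - picardMap n p (p + 1) d (y d) r| ≤ _
      rw [← hyr c hc r hr, ← hyr d hd r hr, ← mul_sub, abs_mul, abs_of_pos (exp_pos _), mul_comm]
      refine mul_le_mul_of_nonneg_right ?_ (exp_pos _).le
      exact (BoundedContinuousFunction.dist_coe_le_dist (f := y c) (g := y d) r).trans
        (hdist c hc d hd)
    · change |-r * radialAvg n (picardSource p (p + 1) c (y c)) r -
        -r * radialAvg n (picardSource p (p + 1) d (y d)) r| ≤ _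
      rw [← mul_sub, radialAvg_sub n (hcs c) (hcs d), neg_mul, abs_neg]
      refine (abs_mul_radialAvg_le hK (by positivity) hr (hsrc c hc d hd)).trans ?_
      gcongr
      rw [div_le_iff₀ hK]
      nlinarith [abs_nonneg (c - d)]

/-- A pair `(w, v)` with `w' = v` solving `v' + (n-1)/r v + |w|^(p-1) w - c w = 0`,
`w 0 = 1`, `v r = - r J r` for a continuous `J`, and `|w| ≤ 1`. -/
structure IsProfile (n : ℕ) (p c : ℝ) (w v J : ℝ → ℝ) : Prop where
  init : w 0 = 1
  deriv_w : ∀ r, HasDerivAt w (v r) r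
  v_eq : ∀ r, v r = -r * J r
  cont_J : Continuous J
  J_zero : n * J 0 = oddPow p (w 0) - c * w 0
  deriv_v : ∀ r, 0 < r → HasDerivAt v (((n : ℝ) - 1) * J r - (oddPow p (w r) - c * w r)) r
  abs_le : ∀ r, 0 ≤ r → |w r| ≤ 1

lemma truncNonlin_of_one_le {p c s : ℝ} (h : 1 ≤ s) : truncNonlin p c s = 1 - c := by
  simp [truncNonlin, clip_of_one_le h, oddPow]

lemma truncNonlin_of_abs_le {p c s : ℝ} (h : |s| ≤ 1) :
    truncNonlin p c s = oddPow p s - c * s := by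
  rw [truncNonlin, clip_of_abs_le h]

lemma hasDerivAt_integral_truncNonlin {p : ℝ} (hp : 1 < p) (c s : ℝ) :
    HasDerivAt (fun x => ∫ t in (0:ℝ)..x, truncNonlin p c t) (truncNonlin p c s) s :=
  intervalIntegral.integral_hasDerivAt_right
    ((continuous_truncNonlin hp c).intervalIntegrable _ _)
    ((continuous_truncNonlin hp c).stronglyMeasurableAtFilter _ _)
    (continuous_truncNonlin hp c).continuousAt

lemma integral_truncNonlin_neg (p c x : ℝ) :
    ∫ t in (0:ℝ)..(-x), truncNonlin p c t = ∫ t in (0:ℝ)..x, truncNonlin p c t := by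
  have h := intervalIntegral.integral_comp_neg (a := 0) (b := x) (fun t => truncNonlin p c t)
  simp only [truncNonlin_neg, intervalIntegral.integral_neg, neg_zero] at h
  rw [intervalIntegral.integral_symm, ← h, neg_neg]

lemma integral_truncNonlin_one_lt {p c x : ℝ} (hp : 1 < p) (hc : c < 1) (hx : 1 < x) :
    ∫ t in (0:ℝ)..1, truncNonlin p c t < ∫ t in (0:ℝ)..x, truncNonlin p c t := by
  have hi := fun a b => (continuous_truncNonlin hp c).intervalIntegrable
    (μ := MeasureTheory.volume) a b
  rw [← intervalIntegral.integral_add_adjacent_intervals (hi 0 1) (hi 1 x)]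
  have : ∫ t in (1:ℝ)..x, truncNonlin p c t = ∫ t in (1:ℝ)..x, (1 - c) := by
    apply intervalIntegral.integral_congr
    intro t ht
    rw [uIcc_of_le hx.le] at ht
    exact truncNonlin_of_one_le ht.1
  rw [this, intervalIntegral.integral_const, smul_eq_mul]
  nlinarith

lemma IsTruncProfile.abs_le {n : ℕ} {p c : ℝ} {w v J : ℝ → ℝ} (hn : 1 ≤ n) (hp : 1 < p)
    (hc : c < 1) (h : IsTruncProfile n p c w v J) {r : ℝ} (hr : 0 ≤ r) : |w r| ≤ 1 := by
  have hn' : (1 : ℝ) ≤ n := by exact_mod_cast hn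
  set H : ℝ → ℝ := fun x => ∫ t in (0:ℝ)..x, truncNonlin p c t with hH
  have hHd : ∀ s, HasDerivAt H (truncNonlin p c s) s := hasDerivAt_integral_truncNonlin hp c
  have hw : Continuous w := continuous_iff_continuousAt.2 fun r => (h.deriv_w r).continuousAt
  have hv : Continuous v := by
    rw [show v = fun r => -r * J r from funext h.v_eq]
    exact continuous_neg.mul h.cont_J
  have hHc : Continuous H := continuous_iff_continuousAt.2 fun r => (hHd r).continuousAt
  have hE : ∀ s, 0 < s → HasDerivAt (fun s => v s ^ 2 / 2 + H (w s))
      (-((n : ℝ) - 1) * s * J s ^ 2) s := by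
    intro s hs
    refine ((((h.deriv_v s hs).pow 2).div_const 2).add
      ((hHd (w s)).comp s (h.deriv_w s))).congr_deriv ?_
    rw [h.v_eq s]
    push_cast
    ring
  have hanti : AntitoneOn (fun s => v s ^ 2 / 2 + H (w s)) (Ici 0) := by
    refine antitoneOn_of_deriv_nonpos (convex_Ici 0) (by fun_prop) ?_ ?_
    · rw [interior_Ici]
      exact fun s hs => (hE s hs).differentiableAt.differentiableWithinAt
    · rw [interior_Ici]
      intro s hs
      rw [(hE s hs).deriv, neg_mul, neg_mul, neg_nonpos]
      have : (0:ℝ) < s := hs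
      have : 0 ≤ (n : ℝ) - 1 := by linarith
      positivity
  have h0 := hanti (mem_Ici.2 le_rfl) (mem_Ici.2 hr) hr
  have hv0 : v 0 = 0 := by rw [h.v_eq]; simp
  simp only [hv0, h.init] at h0
  have hle : H (w r) ≤ H 1 := by nlinarith [sq_nonneg (v r)]
  rw [_root_.abs_le]
  constructor
  · by_contra! hlt
    have := integral_truncNonlin_one_lt hp hc (x := -w r) (by linarith)
    rw [integral_truncNonlin_neg] at this
    exact absurd hle (not_le.2 this)
  · by_contra! hlt
    exact absurd hle (not_le.2 (integral_truncNonlin_one_lt hp hc hlt))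

lemma IsTruncProfile.isProfile {n : ℕ} {p c : ℝ} {w v J : ℝ → ℝ} (hn : 1 ≤ n) (hp : 1 < p)
    (hc : c < 1) (h : IsTruncProfile n p c w v J) : IsProfile n p c w v J where
  init := h.init
  deriv_w := h.deriv_w
  v_eq := h.v_eq
  cont_J := h.cont_J
  J_zero := by rw [h.J_zero, truncNonlin_of_abs_le (h.abs_le hn hp hc le_rfl)]
  deriv_v r hr := by
    have := h.deriv_v r hr
    rwa [truncNonlin_of_abs_le (h.abs_le hn hp hc hr.le)] at this
  abs_le _ hr := h.abs_le hn hp hc hr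

/-- The primitive `|s|^(p+1)/(p+1) - c s²/2` of `|s|^(p-1) s - c s`. -/
noncomputable def potential (p c s : ℝ) : ℝ := |s| ^ (p + 1) / (p + 1) - c * s ^ 2 / 2

/-- The energy `v²/2 + potential w`. -/
noncomputable def energy (p c : ℝ) (w v : ℝ → ℝ) (r : ℝ) : ℝ := v r ^ 2 / 2 + potential p c (w r)

lemma hasDerivAt_potential {p : ℝ} (hp : 1 < p) (c s : ℝ) :
    HasDerivAt (potential p c) (oddPow p s - c * s) s := by
  have h := ((hasDerivAt_abs_rpow s (p := p + 1) (by linarith)).div_const (p + 1)).sub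
    (((hasDerivAt_pow 2 s).const_mul c).div_const 2)
  refine h.congr_deriv ?_
  rw [oddPow, show p + 1 - 2 = p - 1 by ring]
  field_simp
  push_cast
  ring

lemma potential_neg (p c s : ℝ) : potential p c (-s) = potential p c s := by
  simp [potential]

lemma potential_zero {p : ℝ} (hp : 1 < p) (c : ℝ) : potential p c 0 = 0 := by
  simp [potential, Real.zero_rpow (by linarith : p + 1 ≠ 0)]

lemma abs_oddPow_le {p s : ℝ} (hp : 1 < p) (hs : |s| ≤ 1) : |oddPow p s| ≤ |s| := by
  rw [oddPow, abs_mul]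
  refine mul_le_of_le_one_left (abs_nonneg _) ?_
  rw [abs_of_nonneg (Real.rpow_nonneg (abs_nonneg _) _)]
  exact Real.rpow_le_one (abs_nonneg _) hs (by linarith)

lemma nonlin_pos_of_potential_nonneg {p c s : ℝ} (hp : 1 < p) (hc : 0 < c) (hs : 0 < s)
    (h : 0 ≤ potential p c s) : 0 < oddPow p s - c * s := by
  rw [potential, ← oddPow_mul_self hp, sub_nonneg, le_div_iff₀ (by linarith)] at h
  have h1 : 0 < c * s ^ 2 * (p - 1) := mul_pos (by positivity) (by linarith)
  by_contra! hn
  have h2 := mul_le_mul_of_nonneg_right hn hs.le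
  nlinarith

lemma exists_potential_le {p e : ℝ} (hp : 1 < p) (he : 0 < e) :
    ∃ b > 0, ∀ c s, e ≤ c → |s| ≤ b → potential p c s ≤ -(e * s ^ 2 / 4) := by
  refine ⟨(e / 2) ^ (1 / (p - 1)), by positivity, fun c s hc hs => ?_⟩
  have hp' : 0 < p - 1 := by linarith
  have h1 : |s| ^ (p - 1) ≤ e / 2 := by
    calc |s| ^ (p - 1) ≤ ((e / 2) ^ (1 / (p - 1))) ^ (p - 1) := by gcongr
      _ = e / 2 := by
        rw [← Real.rpow_mul (by positivity), one_div_mul_cancel hp'.ne', Real.rpow_one]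
  have h2 : |s| ^ (p + 1) ≤ e / 2 * s ^ 2 := by
    rw [← oddPow_mul_self hp, oddPow, mul_assoc, ← sq]
    gcongr
  have h3 : |s| ^ (p + 1) / (p + 1) ≤ e / 2 * s ^ 2 / 2 := by
    have : 0 ≤ |s| ^ (p + 1) := by positivity
    calc |s| ^ (p + 1) / (p + 1) ≤ |s| ^ (p + 1) / 2 := by gcongr; linarith
      _ ≤ _ := by gcongr
  have h4 : e * s ^ 2 ≤ c * s ^ 2 := by gcongr
  rw [potential]
  linarith

namespace IsProfile

variable {n : ℕ} {p c : ℝ} {w v J : ℝ → ℝ}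

lemma continuous_w (h : IsProfile n p c w v J) : Continuous w :=
  continuous_iff_continuousAt.2 fun r => (h.deriv_w r).continuousAt

lemma continuous_v (h : IsProfile n p c w v J) : Continuous v := by
  rw [show v = fun r => -r * J r from funext h.v_eq]
  exact continuous_neg.mul h.cont_J

lemma continuous_energy (hp : 1 < p) (h : IsProfile n p c w v J) :
    Continuous (energy p c w v) := by
  have h1 : Continuous (potential p c) :=
    continuous_iff_continuousAt.2 fun r => (hasDerivAt_potential hp c r).continuousAt
  have h2 := h.continuous_w
  have h3 := h.continuous_v
  unfold energy
  fun_prop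

lemma deriv_v' (h : IsProfile n p c w v J) {r : ℝ} (hr : 0 < r) :
    HasDerivAt v (-(((n : ℝ) - 1) / r * v r) - (oddPow p (w r) - c * w r)) r := by
  refine (h.deriv_v r hr).congr_deriv ?_
  rw [h.v_eq]
  field_simp

lemma hasDerivAt_energy (hp : 1 < p) (h : IsProfile n p c w v J) {r : ℝ} (hr : 0 < r) :
    HasDerivAt (energy p c w v) (-(((n : ℝ) - 1) / r * v r ^ 2)) r := by
  refine ((((h.deriv_v' hr).pow 2).div_const 2).add
    ((hasDerivAt_potential hp c (w r)).comp r (h.deriv_w r))).congr_deriv ?_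
  push_cast
  ring

lemma antitoneOn_energy (hn : 1 ≤ n) (hp : 1 < p) (h : IsProfile n p c w v J) :
    AntitoneOn (energy p c w v) (Ici 0) := by
  have hn' : (1 : ℝ) ≤ n := by exact_mod_cast hn
  refine antitoneOn_of_deriv_nonpos (convex_Ici 0) (h.continuous_energy hp).continuousOn ?_ ?_ <;>
    rw [interior_Ici]
  · exact fun s hs => (h.hasDerivAt_energy hp hs).differentiableAt.differentiableWithinAt
  · intro s hs
    rw [(h.hasDerivAt_energy hp hs).deriv, neg_nonpos]
    have : (0:ℝ) < s := hs
    have : 0 ≤ (n : ℝ) - 1 := by linarith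
    positivity

lemma v_zero (h : IsProfile n p c w v J) : v 0 = 0 := by rw [h.v_eq]; simp

lemma energy_zero (h : IsProfile n p c w v J) : energy p c w v 0 = 1 / (p + 1) - c / 2 := by
  simp [energy, potential, h.v_zero, h.init]

lemma abs_v_le (hn : 1 ≤ n) (hp : 1 < p) (hc : c ∈ Ico (0:ℝ) 1) (h : IsProfile n p c w v J)
    {r : ℝ} (hr : 0 ≤ r) : |v r| ≤ 2 := by
  have h1 := h.antitoneOn_energy hn hp (mem_Ici.2 le_rfl) (mem_Ici.2 hr) hr
  rw [h.energy_zero, energy, potential] at h1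
  have h2 : 1 / (p + 1) ≤ 1 / 2 := by gcongr; linarith
  have h3 : w r ^ 2 ≤ 1 := (sq_le_one_iff_abs_le_one _).2 (h.abs_le r hr)
  have h4 : 0 ≤ |w r| ^ (p + 1) / (p + 1) := by positivity
  rw [← sq_le_sq₀ (abs_nonneg _) zero_le_two, sq_abs]
  nlinarith [hc.1, hc.2]

lemma v_ne_zero_of_w_eq_zero (hn : 1 ≤ n) (hp : 1 < p) (hc : c ∈ Ico (0:ℝ) 1)
    (h : IsProfile n p c w v J) {r : ℝ} (hr : 0 < r) (hw : w r = 0) : v r ≠ 0 := by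
  intro hv
  have hn' : (1 : ℝ) ≤ n := by exact_mod_cast hn
  have key : Ioo 0 r ⊆ {s | w s = 0} := by
    intro s hs
    set C : ℝ := 3 + 2 * ((n : ℝ) - 1) / s with hC
    have hd : ∀ t, 0 < t → HasDerivAt (fun t => (w t ^ 2 + v t ^ 2) * exp (C * t))
        ((2 * w t * v t + 2 * v t * (-(((n : ℝ) - 1) / t * v t) - (oddPow p (w t) - c * w t)) +
          C * (w t ^ 2 + v t ^ 2)) * exp (C * t)) t := by
      intro t ht
      refine ((((h.deriv_w t).pow 2).add ((h.deriv_v' ht).pow 2)).mul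
        (((hasDerivAt_id t).const_mul C).exp)).congr_deriv ?_
      simp only [id, Pi.add_apply, Pi.pow_apply]
      push_cast
      ring
    have hmono : MonotoneOn (fun t => (w t ^ 2 + v t ^ 2) * exp (C * t)) (Icc s r) := by
      refine monotoneOn_of_deriv_nonneg (convex_Icc s r) ?_ ?_ ?_
      · exact fun t ht => (hd t (hs.1.trans_le ht.1)).continuousAt.continuousWithinAt
      · rw [interior_Icc]
        exact fun t ht => (hd t (hs.1.trans ht.1)).differentiableAt.differentiableWithinAt
      · rw [interior_Icc]
        intro t ht
        have ht0 : 0 < t := hs.1.trans ht.1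
        rw [(hd t ht0).deriv]
        refine mul_nonneg ?_ (exp_pos _).le
        have h1 := abs_oddPow_le hp (h.abs_le t ht0.le)
        have h2 : |v t * oddPow p (w t)| ≤ |v t| * |w t| := by
          rw [abs_mul]; gcongr
        have h3 : 2 * (|v t| * |w t|) ≤ w t ^ 2 + v t ^ 2 := by
          nlinarith [sq_nonneg (|v t| - |w t|), sq_abs (v t), sq_abs (w t)]
        have h4 : ((n : ℝ) - 1) / t * v t ^ 2 ≤ ((n : ℝ) - 1) / s * (w t ^ 2 + v t ^ 2) := by
          have : 0 ≤ (n : ℝ) - 1 := by linarith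
          have hst := ht.1.le
          have hs0 := hs.1
          gcongr
          nlinarith [sq_nonneg (w t)]
        have h5 : |(1 + c) * (w t * v t)| ≤ 2 * (|v t| * |w t|) := by
          rw [abs_mul, abs_mul, abs_of_nonneg (by linarith [hc.1]), mul_comm |w t|]
          gcongr
          linarith [hc.2]
        have h6 := (_root_.abs_le.1 h2).2
        have h7 := (_root_.abs_le.1 h5).1
        have e : 2 * w t * v t + 2 * v t * (-(((n : ℝ) - 1) / t * v t) -
            (oddPow p (w t) - c * w t)) + C * (w t ^ 2 + v t ^ 2) =
            2 * ((1 + c) * (w t * v t)) - 2 * (((n : ℝ) - 1) / t * v t ^ 2) -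
            2 * (v t * oddPow p (w t)) + 3 * (w t ^ 2 + v t ^ 2) +
            2 * (((n : ℝ) - 1) / s * (w t ^ 2 + v t ^ 2)) := by
          rw [hC]; ring
        rw [e]
        linarith
    have h1 := hmono (left_mem_Icc.2 hs.2.le) (right_mem_Icc.2 hs.2.le) hs.2.le
    simp only [hw, hv] at h1
    have h2 : w s ^ 2 + v s ^ 2 ≤ 0 := by
      by_contra! hpos
      have := mul_pos hpos (exp_pos (C * s))
      norm_num at h1
      linarith
    have : w s ^ 2 = 0 := by nlinarith [sq_nonneg (w s), sq_nonneg (v s)]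
    simpa using this
  have hcl : IsClosed {s | w s = 0} := isClosed_eq h.continuous_w continuous_const
  have h0 := hcl.closure_subset_iff.2 key
  rw [closure_Ioo hr.ne] at h0
  have : w 0 = 0 := h0 (left_mem_Icc.2 hr.le)
  rw [h.init] at this
  exact one_ne_zero this

lemma energy_pos_of_w_eq_zero (hn : 1 ≤ n) (hp : 1 < p) (hc : c ∈ Ico (0:ℝ) 1)
    (h : IsProfile n p c w v J) {r s : ℝ} (hs : 0 ≤ s) (hsr : s ≤ r) (hr : 0 < r)
    (hw : w r = 0) : 0 < energy p c w v s := by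
  refine lt_of_lt_of_le ?_ (h.antitoneOn_energy hn hp (mem_Ici.2 hs) (mem_Ici.2 hr.le) hsr)
  have := h.v_ne_zero_of_w_eq_zero hn hp hc hr hw
  rw [energy, hw, potential_zero hp]
  positivity

end IsProfile

/-- A pair `(w, v)` with `w' = v` solving `v' + (n-1)/r v + |w|^(p-1) w - c w = 0` for `r > R`. -/
structure IsTail (n : ℕ) (p c R : ℝ) (w v : ℝ → ℝ) : Prop where
  deriv_w : ∀ r, R < r → HasDerivAt w (v r) r
  deriv_v : ∀ r, R < r →
    HasDerivAt v (-(((n : ℝ) - 1) / r * v r) - (oddPow p (w r) - c * w r)) r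

lemma IsProfile.isTail {n : ℕ} {p c R : ℝ} {w v J : ℝ → ℝ} (h : IsProfile n p c w v J)
    (hR : 0 ≤ R) : IsTail n p c R w v where
  deriv_w r _ := h.deriv_w r
  deriv_v _ hr := h.deriv_v' (hR.trans_lt hr)

lemma IsTail.neg {n : ℕ} {p c R : ℝ} {w v : ℝ → ℝ} (h : IsTail n p c R w v) :
    IsTail n p c R (fun r => -w r) (fun r => -v r) where
  deriv_w r hr := (h.deriv_w r hr).neg
  deriv_v r hr := ((h.deriv_v r hr).neg).congr_deriv (by rw [oddPow_neg]; ring)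

/-- A function without zeros on `(R, ∞)` has constant sign there. -/
lemma pos_or_neg_of_ne_zero {φ : ℝ → ℝ} {R : ℝ} (hφ : ContinuousOn φ (Ioi R))
    (h : ∀ r, R < r → φ r ≠ 0) : (∀ r, R < r → 0 < φ r) ∨ ∀ r, R < r → φ r < 0 := by
  by_contra! hcon
  obtain ⟨⟨a, ha, ha'⟩, b, hb, hb'⟩ := hcon
  have := isPreconnected_Ioi.intermediate_value ha hb hφ
  obtain ⟨x, hx, hx0⟩ := this ⟨ha', hb'⟩
  exact h x hx hx0

/-- If `φ` converges at infinity, its derivative tends to `0` along a sequence. -/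
lemma exists_seq_deriv_tendsto_zero {φ φ' : ℝ → ℝ} {R l : ℝ}
    (hd : ∀ r, R < r → HasDerivAt φ (φ' r) r) (hl : Tendsto φ atTop (nhds l)) :
    ∃ ξ : ℕ → ℝ, Tendsto ξ atTop atTop ∧ Tendsto (fun k => φ' (ξ k)) atTop (nhds 0) := by
  have hx : ∀ k : ℕ, ∃ x, |R| + 1 + k < x ∧ φ' x = φ (|R| + 1 + k + 1) - φ (|R| + 1 + k) := by
    intro k
    have hR : ∀ r, |R| + 1 + k ≤ r → R < r := fun r hr => by
      have := le_abs_self R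
      have : (0:ℝ) ≤ k := k.cast_nonneg
      linarith
    obtain ⟨x, hx, hx'⟩ := exists_hasDerivAt_eq_slope φ φ'
      (show |R| + 1 + (k:ℝ) < |R| + 1 + k + 1 by linarith)
      (fun r hr => (hd r (hR r hr.1)).continuousAt.continuousWithinAt)
      (fun r hr => hd r (hR r hr.1.le))
    exact ⟨x, hx.1, by rw [hx']; simp⟩
  choose ξ h1 h2 using hx
  have ht : Tendsto (fun k : ℕ => |R| + 1 + (k:ℝ)) atTop atTop :=
    tendsto_atTop_add_const_left _ _ tendsto_natCast_atTop_atTop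
  refine ⟨ξ, tendsto_atTop_mono (fun k => (h1 k).le) ht, ?_⟩
  simp only [h2]
  have := (hl.comp (tendsto_atTop_add_const_right _ 1 ht)).sub (hl.comp ht)
  simpa using this

lemma IsTail.tendsto_zero_of_pos {n : ℕ} {p c R : ℝ} {w v : ℝ → ℝ} (hp : 1 < p) (hc : 0 < c)
    (hn : 1 ≤ n) (h : IsTail n p c R w v) (hR : 0 ≤ R) (hpos : ∀ r, R < r → 0 < w r)
    (hbd : ∀ r, R < r → w r ≤ 1) (hE : ∀ r, R < r → 0 ≤ energy p c w v r) :
    Tendsto w atTop (nhds 0) ∧ Tendsto v atTop (nhds 0) := by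
  have hn' : (1 : ℝ) ≤ n := by exact_mod_cast hn
  have hcp : Continuous (potential p c) :=
    continuous_iff_continuousAt.2 fun r => (hasDerivAt_potential hp c r).continuousAt
  obtain ⟨l, hl⟩ : ∃ l, Tendsto w atTop (nhds l) := by
    by_cases hv : ∀ r, R < r → 0 ≤ v r
    · have hm : MonotoneOn w (Ioi R) := by
        refine monotoneOn_of_deriv_nonneg (convex_Ioi R) ?_ ?_ ?_
        · exact fun r hr => (h.deriv_w r hr).continuousAt.continuousWithinAt
        · rw [interior_Ioi]
          exact fun r hr => (h.deriv_w r hr).differentiableAt.differentiableWithinAt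
        · rw [interior_Ioi]
          exact fun r hr => by rw [(h.deriv_w r hr).deriv]; exact hv r hr
      have hm' : Monotone fun r => w (max r (R + 1)) := fun a b hab =>
        hm (mem_Ioi.2 (by linarith [le_max_right a (R + 1)]))
          (mem_Ioi.2 (by linarith [le_max_right b (R + 1)])) (max_le_max_right _ hab)
      refine ⟨_, (tendsto_atTop_ciSup hm' ⟨1, ?_⟩).congr' ?_⟩
      · rintro _ ⟨r, rfl⟩
        exact hbd _ (by linarith [le_max_right r (R + 1)])
      · filter_upwards [eventually_ge_atTop (R + 1)] with r hr
        rw [max_eq_left hr]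
    · push Not at hv
      obtain ⟨a, haR, ha⟩ := hv
      have hva : ∀ r, a ≤ r → v r ≤ 0 := by
        intro r hr
        refine image_le_of_deriv_right_lt_deriv_boundary (f := v) (a := a) (b := r)
          (B := fun _ => 0) (B' := fun _ => 0)
          (fun x hx => (h.deriv_v x (haR.trans_le hx.1)).continuousAt.continuousWithinAt)
          (fun x hx => (h.deriv_v x (haR.trans_le hx.1)).hasDerivWithinAt) ha.le
          (fun x => hasDerivAt_const x 0) (fun x hx hx0 => ?_) (right_mem_Icc.2 hr)
        have hRx := haR.trans_le hx.1
        have h1 := hE x hRx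
        rw [energy, hx0] at h1
        have := nonlin_pos_of_potential_nonneg hp hc (hpos x hRx) (by linarith)
        rw [hx0]
        linarith
      have hm : AntitoneOn w (Ici a) := by
        refine antitoneOn_of_deriv_nonpos (convex_Ici a) ?_ ?_ ?_
        · exact fun r hr => (h.deriv_w r (haR.trans_le hr)).continuousAt.continuousWithinAt
        · rw [interior_Ici]
          exact fun r hr => (h.deriv_w r (haR.trans hr)).differentiableAt.differentiableWithinAt
        · rw [interior_Ici]
          exact fun r hr => by rw [(h.deriv_w r (haR.trans hr)).deriv]; exact hva r (le_of_lt hr)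
      have hm' : Antitone fun r => w (max r a) := fun x y hxy =>
        hm (mem_Ici.2 (le_max_right _ _)) (mem_Ici.2 (le_max_right _ _)) (max_le_max_right _ hxy)
      refine ⟨_, (tendsto_atTop_ciInf hm' ⟨0, ?_⟩).congr' ?_⟩
      · rintro _ ⟨r, rfl⟩
        exact (hpos _ (haR.trans_le (le_max_right _ _))).le
      · filter_upwards [eventually_ge_atTop a] with r hr
        rw [max_eq_left hr]
  have hl0 : 0 ≤ l := ge_of_tendsto hl
    ((eventually_gt_atTop R).mono fun r hr => (hpos r hr).le)
  have hdE : ∀ r, R < r → HasDerivAt (energy p c w v) (-(((n : ℝ) - 1) / r * v r ^ 2)) r := by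
    intro r hr
    refine ((((h.deriv_v r hr).pow 2).div_const 2).add
      ((hasDerivAt_potential hp c (w r)).comp r (h.deriv_w r hr))).congr_deriv ?_
    push_cast
    ring
  obtain ⟨e, he⟩ : ∃ e, Tendsto (energy p c w v) atTop (nhds e) := by
    have hm : AntitoneOn (energy p c w v) (Ioi R) := by
      refine antitoneOn_of_deriv_nonpos (convex_Ioi R) ?_ ?_ ?_
      · exact fun r hr => (hdE r hr).continuousAt.continuousWithinAt
      · rw [interior_Ioi]
        exact fun r hr => (hdE r hr).differentiableAt.differentiableWithinAt
      · rw [interior_Ioi]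
        intro r hr
        rw [(hdE r hr).deriv, neg_nonpos]
        have : 0 < r := hR.trans_lt hr
        have : 0 ≤ (n : ℝ) - 1 := by linarith
        positivity
    have hm' : Antitone fun r => energy p c w v (max r (R + 1)) := fun a b hab =>
      hm (mem_Ioi.2 (by linarith [le_max_right a (R + 1)]))
        (mem_Ioi.2 (by linarith [le_max_right b (R + 1)])) (max_le_max_right _ hab)
    refine ⟨_, (tendsto_atTop_ciInf hm' ⟨0, ?_⟩).congr' ?_⟩
    · rintro _ ⟨r, rfl⟩
      exact hE _ (by linarith [le_max_right r (R + 1)])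
    · filter_upwards [eventually_ge_atTop (R + 1)] with r hr
      rw [max_eq_left hr]
  have he0 : 0 ≤ e := ge_of_tendsto he ((eventually_gt_atTop R).mono fun r hr => hE r hr)
  have hv2 : Tendsto (fun r => v r ^ 2) atTop (nhds (2 * (e - potential p c l))) := by
    refine ((he.sub ((hcp.tendsto l).comp hl)).const_mul 2).congr fun r => ?_
    simp only [energy, Function.comp]
    ring
  have hel : 2 * (e - potential p c l) = 0 := by
    obtain ⟨ξ, hξ, hξ0⟩ := exists_seq_deriv_tendsto_zero h.deriv_w hl
    have := tendsto_nhds_unique (hv2.comp hξ) (hξ0.pow 2)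
    simpa using this
  have hv0 : Tendsto v atTop (nhds 0) := by
    rw [hel] at hv2
    have := hv2.sqrt
    simp only [Real.sqrt_sq_eq_abs, Real.sqrt_zero] at this
    exact (tendsto_zero_iff_abs_tendsto_zero _).2 this
  have hnl : oddPow p l - c * l = 0 := by
    obtain ⟨ξ, hξ, hξ0⟩ := exists_seq_deriv_tendsto_zero h.deriv_v hv0
    have h1 : Tendsto (fun r => -(((n : ℝ) - 1) / r * v r) - (oddPow p (w r) - c * w r)) atTop
        (nhds (-(0 * 0) - (oddPow p l - c * l))) :=
      ((tendsto_const_nhds.div_atTop tendsto_id).mul hv0).neg.sub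
        ((((continuous_oddPow hp).tendsto l).comp hl).sub (hl.const_mul c))
    have := tendsto_nhds_unique (h1.comp hξ) hξ0
    linarith
  have : l = 0 := by
    by_contra hne
    have := nonlin_pos_of_potential_nonneg hp hc (lt_of_le_of_ne hl0 (Ne.symm hne)) (by linarith)
    exact this.ne' hnl
  exact ⟨this ▸ hl, hv0⟩

lemma energy_neg (p c : ℝ) (w v : ℝ → ℝ) (r : ℝ) :
    energy p c (fun r => -w r) (fun r => -v r) r = energy p c w v r := by
  simp [energy, potential_neg]

lemma IsProfile.tendsto_zero {n : ℕ} {p c R : ℝ} {w v J : ℝ → ℝ} (hn : 1 ≤ n) (hp : 1 < p)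
    (hc : 0 < c) (h : IsProfile n p c w v J) (hR : 0 ≤ R) (hne : ∀ r, R < r → w r ≠ 0)
    (hE : ∀ r, 0 ≤ r → 0 ≤ energy p c w v r) :
    Tendsto w atTop (nhds 0) ∧ Tendsto v atTop (nhds 0) := by
  rcases pos_or_neg_of_ne_zero h.continuous_w.continuousOn hne with hpos | hneg
  · exact (h.isTail hR).tendsto_zero_of_pos hp hc hn hR hpos
      (fun r hr => (_root_.abs_le.1 (h.abs_le r (hR.trans hr.le))).2)
      fun r hr => hE r (hR.trans hr.le)
  · have := (h.isTail hR).neg.tendsto_zero_of_pos hp hc hn hR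
      (fun r hr => neg_pos.2 (hneg r hr))
      (fun r hr => by linarith [(_root_.abs_le.1 (h.abs_le r (hR.trans hr.le))).1])
      fun r hr => by rw [energy_neg]; exact hE r (hR.trans hr.le)
    exact ⟨by simpa using this.1.neg, by simpa using this.2.neg⟩

/-- The Pohozaev functional of the equation with `c = 0` in dimension `m + 1`. -/
noncomputable def pohozaev (m : ℕ) (p : ℝ) (w v : ℝ → ℝ) (r : ℝ) : ℝ :=
  r ^ (m + 1) * energy p 0 w v r + ((m : ℝ) - 1) / 2 * (r ^ m * (w r * v r))

lemma IsProfile.hasDerivAt_pohozaev {m : ℕ} {p : ℝ} {w v J : ℝ → ℝ} (hp : 1 < p)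
    (h : IsProfile (m + 1) p 0 w v J) {r : ℝ} (hr : 0 < r) :
    HasDerivAt (pohozaev m p w v)
      ((((m : ℝ) + 1) / (p + 1) - ((m : ℝ) - 1) / 2) * (r ^ m * |w r| ^ (p + 1))) r := by
  have hm : (m : ℝ) * r ^ (m - 1) = m * r ^ m / r := by
    rcases Nat.eq_zero_or_pos m with rfl | hm
    · simp
    · obtain ⟨k, rfl⟩ : ∃ k, m = k + 1 := ⟨m - 1, by omega⟩
      rw [Nat.add_sub_cancel]
      field_simp
      ring
  refine (((hasDerivAt_pow (m + 1) r).mul (h.hasDerivAt_energy hp hr)).add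
    (((hasDerivAt_pow m r).mul ((h.deriv_w r).mul (h.deriv_v' hr))).const_mul
      (((m : ℝ) - 1) / 2))).congr_deriv ?_
  rw [hm, energy, potential, ← oddPow_mul_self hp, Nat.add_sub_cancel, Pi.mul_apply]
  have : p + 1 ≠ 0 := by linarith
  push_cast
  field_simp
  ring

lemma IsProfile.exists_pohozaev_ge {m : ℕ} {p : ℝ} {w v J : ℝ → ℝ} (hm : 1 < m) (hp : 1 < p)
    (hp' : p < ((m : ℝ) + 3) / ((m : ℝ) - 1)) (h : IsProfile (m + 1) p 0 w v J) :
    ∃ δ > 0, ∃ a, ∀ r, a ≤ r → δ ≤ pohozaev m p w v r := by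
  have hm' : (1 : ℝ) < m := by exact_mod_cast hm
  have hκ : 0 < ((m : ℝ) + 1) / (p + 1) - ((m : ℝ) - 1) / 2 := by
    rw [lt_div_iff₀ (by linarith)] at hp'
    rw [sub_pos, div_lt_div_iff₀ (by norm_num) (by linarith)]
    linarith
  have hcont : Continuous (pohozaev m p w v) := by
    have h1 := h.continuous_energy hp
    have h2 := h.continuous_w
    have h3 := h.continuous_v
    unfold pohozaev
    fun_prop
  have hmono : MonotoneOn (pohozaev m p w v) (Ici 0) := by
    refine monotoneOn_of_deriv_nonneg (convex_Ici 0) hcont.continuousOn ?_ ?_ <;>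
      rw [interior_Ici]
    · exact fun s hs => (h.hasDerivAt_pohozaev hp hs).differentiableAt.differentiableWithinAt
    · intro s hs
      rw [(h.hasDerivAt_pohozaev hp hs).deriv]
      have : (0:ℝ) < s := hs
      positivity
  have hw0 : ∀ᶠ r in nhds 0, 0 < w r := by
    have := h.continuous_w.tendsto 0
    rw [h.init] at this
    exact this.eventually_const_lt zero_lt_one
  obtain ⟨a, ha, haw⟩ := Metric.eventually_nhds_iff.1 hw0
  have hstrict : StrictMonoOn (pohozaev m p w v) (Icc 0 (a / 2)) := by
    refine strictMonoOn_of_deriv_pos (convex_Icc _ _) hcont.continuousOn ?_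
    rw [interior_Icc]
    intro s hs
    have hs0 : 0 < s := hs.1
    rw [(h.hasDerivAt_pohozaev hp hs0).deriv]
    have : 0 < w s := haw (by rw [Real.dist_eq, sub_zero, abs_of_pos hs0]; linarith [hs.2])
    positivity
  refine ⟨pohozaev m p w v (a / 2), ?_, a / 2, fun r hr =>
    hmono (mem_Ici.2 (by linarith)) (mem_Ici.2 (by linarith)) hr⟩
  have h0 : pohozaev m p w v 0 = 0 := by
    simp [pohozaev, show m ≠ 0 by omega]
  rw [← h0]
  exact hstrict (left_mem_Icc.2 (by linarith)) (right_mem_Icc.2 (by linarith)) (by linarith)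

lemma IsTail.hasDerivAt_pow_mul_v {m : ℕ} {p R : ℝ} {w v : ℝ → ℝ} (hR : 0 ≤ R)
    (h : IsTail (m + 1) p 0 R w v) {r : ℝ} (hr : R < r) :
    HasDerivAt (fun r => r ^ m * v r) (-(r ^ m * oddPow p (w r))) r := by
  have hr0 : 0 < r := hR.trans_lt hr
  have hm : (m : ℝ) * r ^ (m - 1) = m * r ^ m / r := by
    rcases Nat.eq_zero_or_pos m with rfl | hm
    · simp
    · obtain ⟨k, rfl⟩ : ∃ k, m = k + 1 := ⟨m - 1, by omega⟩
      rw [Nat.add_sub_cancel]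
      field_simp
      ring
  refine ((hasDerivAt_pow m r).mul (h.deriv_v r hr)).congr_deriv ?_
  rw [hm]
  push_cast
  field_simp
  ring

/-- Decay estimates for a positive solution of `w'' + m/r w' + |w|^(p-1) w = 0` near infinity. -/
lemma IsTail.exists_decay_of_pos {m : ℕ} {p R : ℝ} {w v : ℝ → ℝ} (hp : 1 < p) (hR : 0 ≤ R)
    (h : IsTail (m + 1) p 0 R w v) (hpos : ∀ r, R < r → 0 < w r) :
    ∃ a, 0 < a ∧ ∀ r, a ≤ r → v r ≤ 0 ∧ -v r ≤ 2 ^ m * w r / r ∧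
      w r ^ (p - 1) ≤ 2 * 4 ^ m / r ^ 2 := by
  set φ : ℝ → ℝ := fun r => r ^ m * v r with hφ
  have hφd : ∀ r, R < r → HasDerivAt φ (-(r ^ m * oddPow p (w r))) r := fun r hr =>
    h.hasDerivAt_pow_mul_v hR hr
  have hφa : AntitoneOn φ (Ioi R) := by
    refine antitoneOn_of_deriv_nonpos (convex_Ioi R) ?_ ?_ ?_
    · exact fun r hr => (hφd r hr).continuousAt.continuousWithinAt
    · rw [interior_Ioi]
      exact fun r hr => (hφd r hr).differentiableAt.differentiableWithinAt
    · rw [interior_Ioi]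
      intro r hr
      rw [(hφd r hr).deriv, oddPow_of_nonneg hp (hpos r hr).le, neg_nonpos]
      have : 0 < r := hR.trans_lt hr
      have := hpos r hr
      positivity
  obtain ⟨a, haR, ha⟩ : ∃ a, R < a ∧ φ a < 0 := by
    by_contra! hcon
    have hwm : MonotoneOn w (Ioi R) := by
      refine monotoneOn_of_deriv_nonneg (convex_Ioi R) ?_ ?_ ?_
      · exact fun r hr => (h.deriv_w r hr).continuousAt.continuousWithinAt
      · rw [interior_Ioi]
        exact fun r hr => (h.deriv_w r hr).differentiableAt.differentiableWithinAt
      · rw [interior_Ioi]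
        intro r hr
        rw [(h.deriv_w r hr).deriv]
        exact nonneg_of_mul_nonneg_right (hcon r hr) (pow_pos (hR.trans_lt hr) m)
    set b := R + 1 with hb
    have hbR : R < b := by linarith
    have hb0 : 0 < b := by linarith
    have hwb := hpos b hbR
    set κ := b ^ m * w b ^ p with hκ
    have hκ0 : 0 < κ := by positivity
    have hle := Convex.image_sub_le_mul_sub_of_deriv_le (convex_Ici b) (f := φ) (C := -κ)
      (fun r hr => (hφd r (hbR.trans_le hr)).continuousAt.continuousWithinAt)
      (by
        rw [interior_Ici]
        exact fun r hr => (hφd r (hbR.trans hr)).differentiableAt.differentiableWithinAt)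
      (by
        rw [interior_Ici]
        intro r hr
        have hr' : b < r := hr
        have hr0 : 0 < r := hb0.trans hr'
        have hwr : w b ≤ w r := hwm hbR (hbR.trans hr') hr'.le
        rw [(hφd r (hbR.trans hr)).deriv, oddPow_of_nonneg hp (hwb.le.trans hwr), neg_le_neg_iff, hκ]
        gcongr)
      b (mem_Ici.2 le_rfl) (b + (φ b + 1) / κ) (mem_Ici.2 (by
        have := hcon b hbR
        have : 0 ≤ (φ b + 1) / κ := by positivity
        linarith)) (by
        have := hcon b hbR
        have : 0 ≤ (φ b + 1) / κ := by positivity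
        linarith)
    have hnn := hcon (b + (φ b + 1) / κ) (by
        have := hcon b hbR
        have : 0 ≤ (φ b + 1) / κ := by positivity
        linarith)
    have e : -κ * (b + (φ b + 1) / κ - b) = -(φ b + 1) := by field_simp; ring
    rw [e] at hle
    linarith
  have ha0 : 0 < a := hR.trans_lt haR
  have hφneg : ∀ r, a ≤ r → φ r < 0 := fun r hr =>
    (hφa haR (haR.trans_le hr) hr).trans_lt ha
  have hvneg : ∀ r, a ≤ r → v r < 0 := fun r hr =>
    neg_of_mul_neg_right (hφneg r hr) (pow_pos (ha0.trans_le hr) m).le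
  have hwa : AntitoneOn w (Ici a) := by
    refine antitoneOn_of_deriv_nonpos (convex_Ici a) ?_ ?_ ?_
    · exact fun r hr => (h.deriv_w r (haR.trans_le hr)).continuousAt.continuousWithinAt
    · rw [interior_Ici]
      exact fun r hr => (h.deriv_w r (haR.trans hr)).differentiableAt.differentiableWithinAt
    · rw [interior_Ici]
      exact fun r hr => by
        rw [(h.deriv_w r (haR.trans hr)).deriv]; exact (hvneg r (le_of_lt hr)).le
  have hv : ∀ r, a ≤ r → -v r ≤ 2 ^ m * w r / r := by
    intro r hr
    have hr0 := ha0.trans_le hr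
    obtain ⟨s, hs, hs'⟩ := exists_hasDerivAt_eq_slope w v (show r < 2 * r by linarith)
      (fun x hx => (h.deriv_w x (haR.trans_le (hr.trans hx.1))).continuousAt.continuousWithinAt)
      (fun x hx => h.deriv_w x (haR.trans_le (hr.trans hx.1.le)))
    have h1 := hφa (haR.trans_le hr) (haR.trans_le (hr.trans hs.1.le)) hs.1.le
    simp only [hφ] at h1
    have h2 : s ^ m ≤ 2 ^ m * r ^ m := by
      rw [← mul_pow]
      exact pow_le_pow_left₀ (hr0.le.trans hs.1.le) hs.2.le m
    have h3 := hvneg s (hr.trans hs.1.le)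
    have h4 : r ^ m * (-v r) ≤ r ^ m * (2 ^ m * -v s) := by nlinarith
    have h5 := le_of_mul_le_mul_left h4 (pow_pos hr0 m)
    have h6 : -v s ≤ w r / r := by
      rw [hs', show 2 * r - r = r by ring, ← neg_div]
      have := hpos (2 * r) (by linarith)
      gcongr
      linarith
    calc -v r ≤ 2 ^ m * -v s := h5
      _ ≤ 2 ^ m * (w r / r) := by gcongr
      _ = _ := by ring
  refine ⟨2 * a, by positivity, fun x hx => ⟨(hvneg x (by linarith)).le, hv x (by linarith), ?_⟩⟩
  obtain ⟨r, rfl⟩ : ∃ r, x = 2 * r := ⟨x / 2, by ring⟩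
  have hr : a ≤ r := by linarith
  have hr0 := ha0.trans_le hr
  obtain ⟨s, hs, hs'⟩ := exists_hasDerivAt_eq_slope φ (fun r => -(r ^ m * oddPow p (w r)))
    (show r < 2 * r by linarith)
    (fun x hx => (hφd x (haR.trans_le (hr.trans hx.1))).continuousAt.continuousWithinAt)
    (fun x hx => hφd x (haR.trans_le (hr.trans hx.1.le)))
  have hw2 := hpos (2 * r) (by linarith)
  have hws : w (2 * r) ≤ w s := hwa (hr.trans hs.1.le) (by simp only [mem_Ici]; linarith) hs.2.le
  have hwp : 0 < w (2 * r) ^ (p - 1) := by positivity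
  have h1 : r ^ m * w (2 * r) ^ p ≤ s ^ m * oddPow p (w s) := by
    rw [oddPow_of_nonneg hp (hw2.le.trans hws)]
    have hs0 : 0 < s := hr0.trans hs.1
    have := hs.1.le
    gcongr
  have h2 : φ (2 * r) ≤ -(r * (r ^ m * w (2 * r) ^ p)) := by
    rw [show 2 * r - r = r by ring, eq_div_iff hr0.ne'] at hs'
    have := hφneg r hr
    nlinarith
  have h3 := hv (2 * r) (by linarith)
  have h4 : w (2 * r) ^ p = w (2 * r) ^ (p - 1) * w (2 * r) := by
    rw [← Real.rpow_add_one hw2.ne']; simp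
  simp only [hφ, mul_pow] at h2
  have h5 : r ^ m * (r * w (2 * r) ^ p) ≤ r ^ m * (2 ^ m * (2 ^ m * w (2 * r) / (2 * r))) := by
    have : (2 ^ m * r ^ m) * -v (2 * r) ≤
        (2 ^ m * r ^ m) * (2 ^ m * w (2 * r) / (2 * r)) := by gcongr
    nlinarith
  have h6 := le_of_mul_le_mul_left h5 (pow_pos hr0 m)
  rw [h4, show (4:ℝ) ^ m = 2 ^ m * 2 ^ m by rw [← mul_pow]; norm_num]
    at *
  have h7 : w (2 * r) * (w (2 * r) ^ (p - 1)) ≤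
      w (2 * r) * (2 * (2 ^ m * 2 ^ m) / (2 * r) ^ 2) := by
    have e1 : w (2 * r) * (w (2 * r) ^ (p - 1)) =
      (r * (w (2 * r) ^ (p - 1) * w (2 * r))) / r := by field_simp
    have e2 : w (2 * r) * (2 * (2 ^ m * 2 ^ m) / (2 * r) ^ 2) =
      (2 ^ m * (2 ^ m * w (2 * r) / (2 * r))) / r := by field_simp
    rw [e1, e2]
    gcongr
  exact le_of_mul_le_mul_left h7 hw2

lemma IsTail.pohozaev_le_of_pos {m : ℕ} {p R : ℝ} {w v : ℝ → ℝ} (hm : 1 < m) (hp : 1 < p)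
    (hp' : p < ((m : ℝ) + 3) / ((m : ℝ) - 1)) (hR : 0 ≤ R)
    (h : IsTail (m + 1) p 0 R w v) (hpos : ∀ r, R < r → 0 < w r) {δ : ℝ} (hδ : 0 < δ) :
    ∀ᶠ r in atTop, pohozaev m p w v r < δ := by
  have hm' : (1 : ℝ) < m := by exact_mod_cast hm
  obtain ⟨a, ha0, ha⟩ := h.exists_decay_of_pos hp hR hpos
  have hp1 : 0 < p - 1 := by linarith
  set q : ℝ := 2 / (p - 1) with hq
  set A : ℝ := 2 * 4 ^ m with hA
  have hA0 : 0 < A := by positivity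
  set B : ℝ := ((2 ^ m) ^ 2 / 2 + A / (p + 1)) * A ^ q with hB
  have hexp : 0 < 2 * q - ((m : ℝ) - 1) := by
    rw [lt_div_iff₀ (by linarith)] at hp'
    rw [hq, sub_pos, ← mul_div_assoc, lt_div_iff₀ hp1]
    linarith
  have hlim : Tendsto (fun r : ℝ => B * r ^ (-(2 * q - ((m : ℝ) - 1)))) atTop (nhds (B * 0)) :=
    (tendsto_rpow_neg_atTop hexp).const_mul B
  rw [mul_zero] at hlim
  filter_upwards [hlim.eventually_lt_const hδ, eventually_ge_atTop a, eventually_gt_atTop R]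
    with r hr hra hrR
  refine lt_of_le_of_lt ?_ hr
  obtain ⟨h1, h2, h3⟩ := ha r hra
  have hr0 := ha0.trans_le hra
  have hw := hpos r hrR
  have hvsq : v r ^ 2 ≤ (2 ^ m) ^ 2 * w r ^ 2 / r ^ 2 := by
    calc v r ^ 2 = (-v r) ^ 2 := by ring
      _ ≤ (2 ^ m * w r / r) ^ 2 := pow_le_pow_left₀ (by linarith) h2 2
      _ = _ := by ring
  have hwp : |w r| ^ (p + 1) ≤ A * w r ^ 2 / r ^ 2 := by
    rw [← oddPow_mul_self hp, oddPow, abs_of_pos hw]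
    calc w r ^ (p - 1) * w r * w r = w r ^ (p - 1) * w r ^ 2 := by ring
      _ ≤ A / r ^ 2 * w r ^ 2 := by gcongr
      _ = _ := by ring
  have hw2 : w r ^ 2 ≤ A ^ q * r ^ (-(2 * q)) := by
    calc w r ^ 2 = (w r ^ (p - 1)) ^ q := by
          rw [← Real.rpow_mul hw.le, hq, mul_div_cancel₀ _ hp1.ne', Real.rpow_two]
      _ ≤ (A / r ^ 2) ^ q := by gcongr
      _ = A ^ q * r ^ (-(2 * q)) := by
        rw [Real.div_rpow hA0.le (by positivity), ← Real.rpow_natCast, ← Real.rpow_mul hr0.le,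
          Real.rpow_neg hr0.le]
        push_cast
        ring
  have hwv : ((m : ℝ) - 1) / 2 * (r ^ m * (w r * v r)) ≤ 0 := by
    refine mul_nonpos_of_nonneg_of_nonpos (by linarith) ?_
    exact mul_nonpos_of_nonneg_of_nonpos (by positivity)
      (mul_nonpos_of_nonneg_of_nonpos hw.le h1)
  have hen : energy p 0 w v r ≤ ((2 ^ m) ^ 2 / 2 + A / (p + 1)) * (w r ^ 2 / r ^ 2) := by
    rw [energy, potential]
    have : |w r| ^ (p + 1) / (p + 1) ≤ A * w r ^ 2 / r ^ 2 / (p + 1) := by gcongr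
    have e : ((2 ^ m) ^ 2 / 2 + A / (p + 1)) * (w r ^ 2 / r ^ 2) =
      (2 ^ m) ^ 2 * w r ^ 2 / r ^ 2 / 2 + A * w r ^ 2 / r ^ 2 / (p + 1) := by ring
    rw [e]
    linarith
  have hpow : r ^ (m + 1) * (r ^ (-(2 * q)) / r ^ 2) = r ^ (-(2 * q - ((m : ℝ) - 1))) := by
    rw [← Real.rpow_natCast, ← Real.rpow_natCast, ← Real.rpow_sub hr0, ← Real.rpow_add hr0]
    push_cast
    ring_nf
  calc pohozaev m p w v r
      ≤ r ^ (m + 1) * (((2 ^ m) ^ 2 / 2 + A / (p + 1)) * (w r ^ 2 / r ^ 2)) := by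
        rw [pohozaev]
        have := mul_le_mul_of_nonneg_left hen (pow_pos hr0 (m + 1)).le
        linarith
    _ ≤ r ^ (m + 1) * (((2 ^ m) ^ 2 / 2 + A / (p + 1)) *
          (A ^ q * r ^ (-(2 * q)) / r ^ 2)) := by gcongr
    _ = B * (r ^ (m + 1) * (r ^ (-(2 * q)) / r ^ 2)) := by rw [hB]; ring
    _ = _ := by rw [hpow]

/-- Solutions of the subcritical Lane–Emden equation have arbitrarily large zeros. -/
lemma IsProfile.exists_zero_gt {n : ℕ} {p : ℝ} {w v J : ℝ → ℝ} (hn : 3 ≤ n) (hp : 1 < p)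
    (hp' : p < ((n : ℝ) + 2) / ((n : ℝ) - 2)) (h : IsProfile n p 0 w v J) (R : ℝ) :
    ∃ r, R < r ∧ w r = 0 := by
  obtain ⟨m, rfl⟩ : ∃ m, n = m + 1 := ⟨n - 1, by omega⟩
  have hm : 1 < m := by omega
  have hp'' : p < ((m : ℝ) + 3) / ((m : ℝ) - 1) := by
    push_cast at hp'
    convert hp' using 2 <;> ring
  by_contra! hne
  have hne' : ∀ r, max R 0 < r → w r ≠ 0 := fun r hr => hne r ((le_max_left _ _).trans_lt hr)
  have hR := le_max_right R 0
  obtain ⟨δ, hδ, a, ha⟩ := h.exists_pohozaev_ge hm hp hp''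
  rcases pos_or_neg_of_ne_zero h.continuous_w.continuousOn hne' with hpos | hneg
  · obtain ⟨r, h1, h2⟩ := (((h.isTail hR).pohozaev_le_of_pos hm hp hp'' hR hpos hδ).and
      (eventually_ge_atTop a)).exists
    exact absurd h1 (not_lt.2 (ha r h2))
  · obtain ⟨r, h1, h2⟩ := (((h.isTail hR).neg.pohozaev_le_of_pos hm hp hp'' hR
      (fun r hr => neg_pos.2 (hneg r hr)) hδ).and (eventually_ge_atTop a)).exists
    refine absurd h1 (not_lt.2 ((ha r h2).trans_eq ?_))
    simp [pohozaev, energy_neg]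

lemma IsProfile.hasDerivAt_pow_mul_energy {m : ℕ} {p c : ℝ} {w v J : ℝ → ℝ} (hp : 1 < p)
    (h : IsProfile (m + 1) p c w v J) {r : ℝ} (hr : 0 < r) :
    HasDerivAt (fun r => r ^ (2 * m) * energy p c w v r)
      (2 * m * r ^ (2 * m - 1) * potential p c (w r)) r := by
  refine ((hasDerivAt_pow (2 * m) r).mul (h.hasDerivAt_energy hp hr)).congr_deriv ?_
  have hm : (m : ℝ) * r ^ (2 * m) = m * (r ^ (2 * m - 1) * r) := by
    rcases Nat.eq_zero_or_pos m with rfl | hm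
    · simp
    · rw [← pow_succ, show 2 * m - 1 + 1 = 2 * m by omega]
  have : r ^ (2 * m) * -((((m + 1 : ℕ) : ℝ) - 1) / r * v r ^ 2) =
      -(m * r ^ (2 * m - 1) * v r ^ 2) := by
    push_cast
    rw [add_sub_cancel_right]
    field_simp
    linear_combination (-v r ^ 2) * hm
  rw [this, energy]
  push_cast
  ring

/-- A solution that is small at a large radius `R`, with small weighted energy there, vanishes at
most once beyond `R`. -/
lemma IsProfile.eq_of_w_eq_zero {m : ℕ} {p c e b R : ℝ} {w v J : ℝ → ℝ} (hm : 1 ≤ m)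
    (hp : 1 < p) (hc : c ∈ Ico (0:ℝ) 1) (h : IsProfile (m + 1) p c w v J) (he : 0 < e)
    (hb : 0 < b) (hpot : ∀ s, |s| ≤ b → potential p c s ≤ -(e * s ^ 2 / 4)) (hR : 1 ≤ R)
    (hwR : |w R| ≤ b / 2) (hG : R ^ (2 * m) * energy p c w v R < R * (e * b ^ 3 / 32))
    {r₁ r₃ : ℝ} (h1 : R < r₁) (h13 : r₁ < r₃) (hw1 : w r₁ = 0) (hw3 : w r₃ = 0) : False := by
  have hn : 1 ≤ m + 1 := by omega
  have hw := h.continuous_w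
  obtain ⟨q, hq, hvq⟩ := exists_hasDerivAt_eq_zero h13 hw.continuousOn (hw1.trans hw3.symm)
    fun x _ => h.deriv_w x
  have hpos : ∀ s, R ≤ s → s ≤ r₃ → 0 < energy p c w v s := fun s hs hs3 =>
    h.energy_pos_of_w_eq_zero hn hp hc (by linarith) hs3 (by linarith) hw3
  have hwq : b < |w q| := by
    by_contra! hcon
    have h2 := hpos q (h1.le.trans hq.1.le) hq.2.le
    have h3 := hpot _ hcon
    rw [energy, hvq] at h2
    nlinarith [mul_nonneg he.le (sq_nonneg (w q))]
  obtain ⟨t, ⟨htI, htb⟩, htmin⟩ : ∃ t, IsLeast (Icc R q ∩ {r | b ≤ |w r|}) t :=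
    (isCompact_Icc.inter_right (isClosed_le continuous_const hw.abs)).exists_isLeast
      ⟨q, ⟨(h1.trans hq.1).le, le_rfl⟩, hwq.le⟩
  have htb : b ≤ |w t| := htb
  have hlt : ∀ r, R ≤ r → r < t → |w r| < b := by
    intro r hr hrt
    by_contra! hcon
    exact absurd (htmin ⟨⟨hr, hrt.le.trans htI.2⟩, hcon⟩) (not_le.2 hrt)
  obtain ⟨s, ⟨hsI, hsb⟩, hsmax⟩ : ∃ s, IsGreatest (Icc R t ∩ {r | |w r| ≤ b / 2}) s :=
    (isCompact_Icc.inter_right (isClosed_le hw.abs continuous_const)).exists_isGreatest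
      ⟨R, ⟨le_rfl, htI.1⟩, hwR⟩
  have hsb : |w s| ≤ b / 2 := hsb
  have hst : s < t := by
    refine hsI.2.lt_of_ne ?_
    rintro rfl
    linarith
  have hgt : ∀ r, s < r → r ≤ t → b / 2 < |w r| := by
    intro r hr hrt
    by_contra! hcon
    exact absurd (hsmax ⟨⟨hsI.1.trans hr.le, hrt⟩, hcon⟩) (not_le.2 hr)
  have hd : ∀ r, R ≤ r → HasDerivAt (fun r => r ^ (2 * m) * energy p c w v r)
      (2 * m * r ^ (2 * m - 1) * potential p c (w r)) r := fun r hr =>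
    h.hasDerivAt_pow_mul_energy hp (by linarith)
  have hmono : s ^ (2 * m) * energy p c w v s ≤ R ^ (2 * m) * energy p c w v R := by
    refine antitoneOn_of_deriv_nonpos (convex_Icc R s)
      (fun r hr => (hd r hr.1).continuousAt.continuousWithinAt) ?_ ?_
      (left_mem_Icc.2 hsI.1) (right_mem_Icc.2 hsI.1) hsI.1 <;> rw [interior_Icc]
    · exact fun r hr => (hd r hr.1.le).differentiableAt.differentiableWithinAt
    · intro r hr
      rw [(hd r hr.1.le).deriv]
      have hr0 : 0 < r := by linarith [hr.1]
      refine mul_nonpos_of_nonneg_of_nonpos (by positivity) ?_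
      have := hpot (w r) (hlt r hr.1.le (hr.2.trans hst)).le
      nlinarith [mul_nonneg he.le (sq_nonneg (w r))]
  have hdrop := (convex_Icc s t).image_sub_le_mul_sub_of_deriv_le
    (f := fun r => r ^ (2 * m) * energy p c w v r) (C := -(R * (e * b ^ 2 / 8)))
    (fun r hr => (hd r (hsI.1.trans hr.1)).continuousAt.continuousWithinAt)
    (by
      rw [interior_Icc]
      exact fun r hr => (hd r (hsI.1.trans hr.1.le)).differentiableAt.differentiableWithinAt)
    (by
      rw [interior_Icc]
      intro r hr
      have hRr := hsI.1.trans hr.1.le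
      rw [(hd r hRr).deriv]
      have h2 := hpot (w r) (hlt r hRr hr.2).le
      have h3 := hgt r hr.1 hr.2.le
      have h4 : (b / 2) ^ 2 ≤ w r ^ 2 := by
        rw [← sq_abs (w r)]
        exact pow_le_pow_left₀ (by linarith) h3.le 2
      have h5 : potential p c (w r) ≤ -(e * b ^ 2 / 16) := by nlinarith
      have h6 : R ≤ r ^ (2 * m - 1) := by
        refine hRr.trans (le_self_pow₀ (hR.trans hRr) (by omega))
      have h7 : (1:ℝ) ≤ m := by exact_mod_cast hm
      have h8 : 2 * R ≤ 2 * m * r ^ (2 * m - 1) := by nlinarith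
      have h9 : 0 ≤ e * b ^ 2 / 16 := by positivity
      nlinarith)
    s (left_mem_Icc.2 hst.le) t (right_mem_Icc.2 hst.le) hst.le
  obtain ⟨x, hx, hvx⟩ := exists_hasDerivAt_eq_slope w v hst hw.continuousOn
    fun x _ => h.deriv_w x
  have hvx2 := h.abs_v_le hn hp hc (r := x) (by linarith [hx.1, hsI.1])
  rw [hvx, abs_div, abs_of_pos (sub_pos.2 hst), div_le_iff₀ (sub_pos.2 hst)] at hvx2
  have hlen : b / 4 ≤ t - s := by
    have := abs_sub_abs_le_abs_sub (w t) (w s)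
    linarith
  have ht0 : 0 < t := by linarith [htI.1]
  have hGt : 0 < t ^ (2 * m) * energy p c w v t :=
    mul_pos (pow_pos ht0 _) (hpos t htI.1 (htI.2.trans hq.2.le))
  have : R * (e * b ^ 2 / 8) * (b / 4) ≤ R * (e * b ^ 2 / 8) * (t - s) := by gcongr
  nlinarith

/-- If `w` tends to zero, then its weighted energy is bounded near infinity by a constant. -/
lemma IsProfile.exists_pow_mul_energy_le {m : ℕ} {p c e b : ℝ} {w v J : ℝ → ℝ}
    (hp : 1 < p) (h : IsProfile (m + 1) p c w v J) (he : 0 < e)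
    (hb : 0 < b) (hpot : ∀ s, |s| ≤ b → potential p c s ≤ -(e * s ^ 2 / 4))
    (hw : Tendsto w atTop (nhds 0)) :
    ∃ C, ∀ᶠ r in atTop, r ^ (2 * m) * energy p c w v r ≤ C := by
  have hev : ∀ᶠ r in atTop, |w r| < b := by
    have := hw.abs
    rw [abs_zero] at this
    exact this.eventually_lt_const hb
  obtain ⟨a, ha⟩ := eventually_atTop.1 (hev.and (eventually_gt_atTop 0))
  refine ⟨a ^ (2 * m) * energy p c w v a, eventually_atTop.2 ⟨a, fun r hr => ?_⟩⟩
  have hd : ∀ r, a ≤ r → HasDerivAt (fun r => r ^ (2 * m) * energy p c w v r)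
      (2 * m * r ^ (2 * m - 1) * potential p c (w r)) r := fun r hr =>
    h.hasDerivAt_pow_mul_energy hp (ha r hr).2
  refine antitoneOn_of_deriv_nonpos (convex_Ici a)
    (fun r hr => (hd r hr).continuousAt.continuousWithinAt) ?_ ?_
    (mem_Ici.2 le_rfl) (mem_Ici.2 hr) hr <;> rw [interior_Ici]
  · exact fun r hr => (hd r (le_of_lt hr)).differentiableAt.differentiableWithinAt
  · intro r hr
    rw [(hd r (le_of_lt hr)).deriv]
    obtain ⟨h1, h2⟩ := ha r (le_of_lt hr)
    refine mul_nonpos_of_nonneg_of_nonpos (by positivity) ?_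
    have := hpot (w r) h1.le
    nlinarith [mul_nonneg he.le (sq_nonneg (w r))]

/-- A family of profiles depending continuously on the parameter. -/
structure IsProfileFamily (n : ℕ) (p : ℝ) (w v J : ℝ → ℝ → ℝ) : Prop where
  isProfile : ∀ c ∈ Ico (0:ℝ) 1, IsProfile n p c (w c) (v c) (J c)
  abs_w_sub_le : ∀ c ∈ Ico (0:ℝ) 1, ∀ d ∈ Ico (0:ℝ) 1, ∀ r, 0 ≤ r →
    |w c r - w d r| ≤ |c - d| * exp ((p + 1) * r)
  abs_v_sub_le : ∀ c ∈ Ico (0:ℝ) 1, ∀ d ∈ Ico (0:ℝ) 1, ∀ r, 0 ≤ r →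
    |v c r - v d r| ≤ 2 * |c - d| * exp ((p + 1) * r)

lemma exists_profile_family {n : ℕ} (hn : 2 ≤ n) {p : ℝ} (hp : 1 < p) :
    ∃ w v J : ℝ → ℝ → ℝ, IsProfileFamily n p w v J := by
  obtain ⟨w, v, J, h1, h2⟩ := exists_truncProfile_family hn hp
  exact ⟨w, v, J, fun c hc => (h1 c ⟨hc.1, hc.2.le⟩).isProfile (by omega) hp hc.2,
    fun c hc d hd r hr => (h2 c ⟨hc.1, hc.2.le⟩ d ⟨hd.1, hd.2.le⟩ r hr).1,
    fun c hc d hd r hr => (h2 c ⟨hc.1, hc.2.le⟩ d ⟨hd.1, hd.2.le⟩ r hr).2⟩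

namespace IsProfileFamily

variable {n : ℕ} {p : ℝ} {w v J : ℝ → ℝ → ℝ}

lemma tendsto_w {ι : Type*} {l : Filter ι} {cs rs : ι → ℝ} {c r : ℝ}
    (hF : IsProfileFamily n p w v J) (hc : c ∈ Ico (0:ℝ) 1)
    (hcs : Tendsto cs l (nhdsWithin c (Ico 0 1))) (hrs : Tendsto rs l (nhds r))
    (hrs0 : ∀ᶠ i in l, 0 ≤ rs i) : Tendsto (fun i => w (cs i) (rs i)) l (nhds (w c r)) := by
  obtain ⟨hcs1, hcs2⟩ := tendsto_nhdsWithin_iff.1 hcs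
  have h1 : Tendsto (fun i => w (cs i) (rs i) - w c (rs i)) l (nhds 0) := by
    have h2 : Tendsto (fun i => |cs i - c| * exp ((p + 1) * rs i)) l
        (nhds (|c - c| * exp ((p + 1) * r))) :=
      (hcs1.sub_const c).abs.mul
        (continuous_exp.continuousAt.tendsto.comp (hrs.const_mul (p + 1)))
    rw [sub_self, abs_zero, zero_mul] at h2
    refine squeeze_zero_norm' ?_ h2
    filter_upwards [hcs2, hrs0] with i hi hi0
    exact hF.abs_w_sub_le _ hi _ hc _ hi0
  simpa using h1.add (((hF.isProfile c hc).continuous_w.tendsto r).comp hrs)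

lemma tendsto_v {ι : Type*} {l : Filter ι} {cs rs : ι → ℝ} {c r : ℝ}
    (hF : IsProfileFamily n p w v J) (hc : c ∈ Ico (0:ℝ) 1)
    (hcs : Tendsto cs l (nhdsWithin c (Ico 0 1))) (hrs : Tendsto rs l (nhds r))
    (hrs0 : ∀ᶠ i in l, 0 ≤ rs i) : Tendsto (fun i => v (cs i) (rs i)) l (nhds (v c r)) := by
  obtain ⟨hcs1, hcs2⟩ := tendsto_nhdsWithin_iff.1 hcs
  have h1 : Tendsto (fun i => v (cs i) (rs i) - v c (rs i)) l (nhds 0) := by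
    have h2 : Tendsto (fun i => 2 * |cs i - c| * exp ((p + 1) * rs i)) l
        (nhds (2 * |c - c| * exp ((p + 1) * r))) :=
      ((hcs1.sub_const c).abs.const_mul 2).mul
        (continuous_exp.continuousAt.tendsto.comp (hrs.const_mul (p + 1)))
    rw [sub_self, abs_zero, mul_zero, zero_mul] at h2
    refine squeeze_zero_norm' ?_ h2
    filter_upwards [hcs2, hrs0] with i hi hi0
    exact hF.abs_v_sub_le _ hi _ hc _ hi0
  simpa using h1.add (((hF.isProfile c hc).continuous_v.tendsto r).comp hrs)

lemma tendsto_energy {c r : ℝ} (hp : 1 < p) (hF : IsProfileFamily n p w v J)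
    (hc : c ∈ Ico (0:ℝ) 1) (hr : 0 ≤ r) :
    Tendsto (fun d => energy p d (w d) (v d) r) (nhdsWithin c (Ico 0 1))
      (nhds (energy p c (w c) (v c) r)) := by
  have h1 := hF.tendsto_w hc tendsto_id (tendsto_const_nhds (x := r)) (.of_forall fun _ => hr)
  have h2 := hF.tendsto_v hc tendsto_id (tendsto_const_nhds (x := r)) (.of_forall fun _ => hr)
  have h3 : Tendsto (fun d : ℝ => d) (nhdsWithin c (Ico 0 1)) (nhds c) :=
    tendsto_nhdsWithin_of_tendsto_nhds tendsto_id
  exact ((h2.pow 2).div_const 2).add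
    (((h1.abs.rpow_const (Or.inr (by linarith))).div_const (p + 1)).sub
      ((h3.mul (h1.pow 2)).div_const 2))

/-- Near a parameter whose profile tends to zero, profiles vanish at most once beyond some
radius. -/
lemma eventually_eq_of_w_eq_zero {m : ℕ} {c : ℝ} (hm : 1 ≤ m) (hp : 1 < p)
    (hF : IsProfileFamily (m + 1) p w v J) (hc : c ∈ Ioo (0:ℝ) 1)
    (hw : Tendsto (w c) atTop (nhds 0)) :
    ∀ᶠ R in atTop, ∀ᶠ d in nhdsWithin c (Ico 0 1), ∀ r₁ r₃, R < r₁ → r₁ < r₃ →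
      w d r₁ = 0 → w d r₃ = 0 → False := by
  have hc' : c ∈ Ico (0:ℝ) 1 := ⟨hc.1.le, hc.2⟩
  have he : 0 < c / 2 := half_pos hc.1
  obtain ⟨b, hb, hpot⟩ := exists_potential_le hp he
  obtain ⟨C, hC⟩ := (hF.isProfile c hc').exists_pow_mul_energy_le hp he hb
    (fun s hs => hpot c s (by linarith [hc.1]) hs) hw
  have hwev : ∀ᶠ r in atTop, |w c r| < b / 2 := by
    have := hw.abs
    rw [abs_zero] at this
    exact this.eventually_lt_const (half_pos hb)
  have hκ : 0 < c / 2 * b ^ 3 / 32 := by positivity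
  filter_upwards [hC, hwev, eventually_ge_atTop 1,
    (tendsto_id.atTop_mul_const hκ).eventually_gt_atTop C] with R h1 h2 h3 h4
  have hR0 : 0 ≤ R := by linarith
  filter_upwards [self_mem_nhdsWithin,
    (hF.tendsto_w hc' tendsto_id (tendsto_const_nhds (x := R))
      (.of_forall fun _ => hR0)).abs.eventually_lt_const h2,
    ((hF.tendsto_energy hp hc' hR0).const_mul (R ^ (2 * m))).eventually_lt_const
      (h1.trans_lt h4),
    nhdsWithin_le_nhds (eventually_gt_nhds (half_lt_self hc.1))] with d hd hd1 hd2 hd3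
  intro r₁ r₃ hr1 hr13 hw1 hw3
  exact (hF.isProfile d hd).eq_of_w_eq_zero hm hp hd he hb
    (fun s hs => hpot d s hd3.le hs) h3 hd1.le hd2 hr1 hr13 hw1 hw3

/-- The number of zeros in a bounded interval is upper semicontinuous in the parameter. -/
lemma eventually_not_exists_zeros {m : ℕ} {c R : ℝ} (hn : 1 ≤ n) (hp : 1 < p)
    (hF : IsProfileFamily n p w v J) (hc : c ∈ Ico (0:ℝ) 1)
    (h : ¬∃ z : Fin m → ℝ, StrictMono z ∧ ∀ i, z i ∈ Ioc 0 R ∧ w c (z i) = 0) :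
    ∀ᶠ d in nhdsWithin c (Ico 0 1),
      ¬∃ z : Fin m → ℝ, StrictMono z ∧ ∀ i, z i ∈ Ioc 0 R ∧ w d (z i) = 0 := by
  by_contra hcon
  rw [← Filter.Frequently] at hcon
  obtain ⟨cs, hcs, hz⟩ := exists_seq_forall_of_frequently
    (hcon.and_eventually self_mem_nhdsWithin)
  have hcsI := fun k => (hz k).2
  choose z hzm hz using fun k => (hz k).1
  obtain ⟨a, haI, φ, hφ, ha⟩ := (isCompact_univ_pi
    (fun _ : Fin m => isCompact_Icc (a := (0:ℝ)) (b := R))).tendsto_subseq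
    (x := z) (fun k i _ => ⟨(hz k i).1.1.le, (hz k i).1.2⟩)
  have hcs' := hcs.comp hφ.tendsto_atTop
  have ha' : ∀ i, Tendsto (fun k => z (φ k) i) atTop (nhds (a i)) := tendsto_pi_nhds.1 ha
  have hP := hF.isProfile c hc
  have hwa : ∀ i, w c (a i) = 0 := fun i => by
    have h1 := hF.tendsto_w hc hcs' (ha' i) (.of_forall fun k => (hz _ i).1.1.le)
    refine tendsto_nhds_unique h1 (tendsto_const_nhds.congr fun k => ?_)
    exact (hz (φ k) i).2.symm
  have ha0 : ∀ i, 0 < a i := fun i => by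
    refine (haI i (mem_univ i)).1.lt_of_ne fun h0 => ?_
    have := hwa i
    rw [← h0, hP.init] at this
    exact one_ne_zero this
  refine h ⟨a, fun i j hij => ?_, fun i => ⟨⟨ha0 i, (haI i (mem_univ i)).2⟩, hwa i⟩⟩
  refine (le_of_tendsto_of_tendsto' (ha' i) (ha' j) fun k => (hzm _ hij).le).lt_of_ne fun heq => ?_
  have hx : ∀ k, ∃ x ∈ Ioo (z (φ k) i) (z (φ k) j), v (cs (φ k)) x = 0 := fun k =>
    exists_hasDerivAt_eq_zero (hzm _ hij)
      (hF.isProfile _ (hcsI (φ k))).continuous_w.continuousOn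
      ((hz (φ k) i).2.trans (hz (φ k) j).2.symm) fun x _ => (hF.isProfile _ (hcsI (φ k))).deriv_w x
  choose x hxI hx using hx
  have hxa : Tendsto x atTop (nhds (a i)) :=
    tendsto_of_tendsto_of_tendsto_of_le_of_le (ha' i) (heq ▸ ha' j)
      (fun k => (hxI k).1.le) (fun k => (hxI k).2.le)
  have h1 := hF.tendsto_v hc hcs' hxa
    (.of_forall fun k => (hz (φ k) i).1.1.le.trans (hxI k).1.le)
  refine hP.v_ne_zero_of_w_eq_zero hn hp hc (ha0 i) (hwa i)
    (tendsto_nhds_unique h1 (tendsto_const_nhds.congr fun k => (hx k).symm))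

lemma eventually_exists_zero {c z ε : ℝ} (hn : 1 ≤ n) (hp : 1 < p)
    (hF : IsProfileFamily n p w v J) (hc : c ∈ Ico (0:ℝ) 1) (hz : 0 < z) (hwz : w c z = 0)
    (hε : 0 < ε) (hεz : ε < z) :
    ∀ᶠ d in nhdsWithin c (Ico 0 1), ∃ x ∈ Ioo (z - ε) (z + ε), w d x = 0 := by
  have hP := hF.isProfile c hc
  set κ := v c z with hκ
  have hκ0 : κ ≠ 0 := hP.v_ne_zero_of_w_eq_zero hn hp hc hz hwz
  have hslope : ∀ᶠ x in nhdsWithin z {z}ᶜ, 0 < slope (w c) z x * κ :=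
    ((hasDerivAt_iff_tendsto_slope.1 (hP.deriv_w z)).mul_const κ).eventually_const_lt
      (mul_self_pos.2 hκ0)
  have hslope' : ∀ x, slope (w c) z x * κ = w c x * κ / (x - z) := fun x => by
    rw [slope_def_field, hwz, sub_zero, div_mul_eq_mul_div]
  simp only [hslope'] at hslope
  obtain ⟨a, ha1, ha2⟩ := ((hslope.filter_mono (nhdsLT_le_nhdsNE z)).and
    (Ioo_mem_nhdsLT (show z - ε < z by linarith))).exists
  obtain ⟨b, hb1, hb2⟩ := ((hslope.filter_mono (nhdsGT_le_nhdsNE z)).and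
    (Ioo_mem_nhdsGT (show z < z + ε by linarith))).exists
  have ha3 : w c a * κ < 0 := by
    by_contra! hcon
    exact absurd ha1 (not_lt.2 (div_nonpos_of_nonneg_of_nonpos hcon (by linarith [ha2.2])))
  have hb3 : 0 < w c b * κ := by
    by_contra! hcon
    exact absurd hb1 (not_lt.2 (div_nonpos_of_nonpos_of_nonneg hcon (by linarith [hb2.1])))
  have ha0 : 0 ≤ a := by linarith [ha2.1]
  have hb0 : 0 ≤ b := by linarith [hb2.1]
  filter_upwards [self_mem_nhdsWithin,
    ((hF.tendsto_w hc tendsto_id (tendsto_const_nhds (x := a))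
      (.of_forall fun _ => ha0)).mul_const κ).eventually_lt_const ha3,
    ((hF.tendsto_w hc tendsto_id (tendsto_const_nhds (x := b))
      (.of_forall fun _ => hb0)).mul_const κ).eventually_const_lt hb3] with d hd hda hdb
  obtain ⟨x, hx, hx0⟩ := intermediate_value_Ioo (show a ≤ b by linarith [ha2.2, hb2.1])
    ((hF.isProfile d hd).continuous_w.mul_const κ).continuousOn ⟨hda, hdb⟩
  exact ⟨x, ⟨ha2.1.trans hx.1, hx.2.trans hb2.2⟩, (mul_eq_zero.1 hx0).resolve_right hκ0⟩

end IsProfileFamily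

/-- `φ` has at least `m` zeros in `(0, ∞)`. -/
def HasZeros (φ : ℝ → ℝ) (m : ℕ) : Prop :=
  ∃ z : Fin m → ℝ, StrictMono z ∧ ∀ i, 0 < z i ∧ φ (z i) = 0

/-- The number of positive zeros is lower semicontinuous in the parameter. -/
lemma IsProfileFamily.eventually_hasZeros {n m : ℕ} {p c : ℝ} {w v J : ℝ → ℝ → ℝ} (hn : 1 ≤ n)
    (hp : 1 < p) (hF : IsProfileFamily n p w v J) (hc : c ∈ Ico (0:ℝ) 1)
    (h : HasZeros (w c) m) : ∀ᶠ d in nhdsWithin c (Ico 0 1), HasZeros (w d) m := by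
  obtain ⟨z, hzm, hz⟩ := h
  have hε : ∀ᶠ ε in nhdsWithin (0:ℝ) (Ioi 0), 0 < ε ∧ (∀ i, ε < z i) ∧
      ∀ i j, i < j → z i + ε < z j - ε := by
    refine (eventually_mem_nhdsWithin (s := Ioi (0:ℝ))).and (.and ?_ ?_)
    · exact eventually_all.2 fun i => nhdsWithin_le_nhds (eventually_lt_nhds (hz i).1)
    · refine eventually_all.2 fun i => eventually_all.2 fun j => ?_
      by_cases hij : i < j
      · filter_upwards [nhdsWithin_le_nhds (eventually_lt_nhds
          (show 0 < (z j - z i) / 2 by linarith [hzm hij]))] with ε hε _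
        linarith
      · exact .of_forall fun ε h => absurd h hij
  obtain ⟨ε, hε0, hεz, hεd⟩ := hε.exists
  filter_upwards [eventually_all.2 fun i =>
    hF.eventually_exists_zero hn hp hc (hz i).1 (hz i).2 hε0 (hεz i)] with d hd
  choose x hxI hx using hd
  exact ⟨x, fun i j hij => (hxI i).2.trans ((hεd i j hij).trans (hxI j).1),
    fun i => ⟨(sub_pos.2 (hεz i)).trans (hxI i).1, hx i⟩⟩

lemma hasZeros_of_finset {φ : ℝ → ℝ} (s : Finset ℝ) (hs : ∀ x ∈ s, 0 < x ∧ φ x = 0) :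
    HasZeros φ s.card :=
  ⟨s.orderEmbOfFin rfl, (s.orderEmbOfFin rfl).strictMono,
    fun i => hs _ (s.orderEmbOfFin_mem rfl i)⟩

lemma hasZeros_of_forall_exists_gt {φ : ℝ → ℝ} (h : ∀ R, ∃ r, R < r ∧ φ r = 0) (m : ℕ) :
    HasZeros φ m := by
  choose g hg1 hg2 using h
  have hmono : StrictMono fun i : ℕ => g^[i] 0 := strictMono_nat_of_lt_succ fun i => by
    rw [Function.iterate_succ_apply']
    exact hg1 _
  refine ⟨fun i => g^[(i : ℕ) + 1] 0, fun i j hij => hmono (Nat.succ_lt_succ hij),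
    fun i => ⟨hmono (Nat.succ_pos i), ?_⟩⟩
  simp only [Function.iterate_succ_apply', hg2]

lemma exists_exactZeros {φ : ℝ → ℝ} {k : ℕ} (h : HasZeros φ k) (h' : ¬HasZeros φ (k + 1)) :
    ∃ z : Fin k → ℝ, ExactZeros φ k z := by
  obtain ⟨z, hz1, hz2⟩ := h
  refine ⟨z, hz1, hz2, fun r hr hφ => ?_⟩
  by_contra! hne
  refine h' ?_
  have hr' : r ∉ Finset.univ.image z := by
    simpa using fun i => (hne i).symm
  have := hasZeros_of_finset (φ := φ) (insert r (Finset.univ.image z)) (by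
    intro x hx
    rcases Finset.mem_insert.1 hx with rfl | hx
    · exact ⟨hr, hφ⟩
    · obtain ⟨i, -, rfl⟩ := Finset.mem_image.1 hx
      exact hz2 i)
  rwa [Finset.card_insert_of_notMem hr', Finset.card_image_of_injective _ hz1.injective,
    Finset.card_univ, Fintype.card_fin] at this

lemma IsProfile.hasDerivAt_v {n : ℕ} {p c : ℝ} {w v J : ℝ → ℝ} (h : IsProfile n p c w v J)
    {r : ℝ} (hr : 0 ≤ r) :
    HasDerivAt v (((n : ℝ) - 1) * J r - (oddPow p (w r) - c * w r)) r := by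
  rcases hr.eq_or_lt with rfl | hr
  · rw [← h.J_zero, show ((n : ℝ) - 1) * J 0 - n * J 0 = -J 0 by ring,
      hasDerivAt_iff_tendsto_slope]
    refine ((h.cont_J.tendsto 0).neg.mono_left nhdsWithin_le_nhds).congr' ?_
    filter_upwards [self_mem_nhdsWithin] with x hx
    have hx : x ≠ 0 := hx
    rw [slope_def_field, h.v_zero, h.v_eq]
    field_simp
    ring
  · exact h.deriv_v r hr

/-- For each `k` some profile of the family decays and has exactly `k` positive zeros. -/
lemma exists_profile_exactZeros {n : ℕ} {p : ℝ} (hn : 3 ≤ n) (hp : 1 < p)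
    (hp' : p < ((n : ℝ) + 2) / ((n : ℝ) - 2)) (k : ℕ) :
    ∃ c ∈ Ioo (0:ℝ) 1, ∃ w v J : ℝ → ℝ, IsProfile n p c w v J ∧ Tendsto w atTop (nhds 0) ∧
      Tendsto v atTop (nhds 0) ∧ ∃ z : Fin k → ℝ, ExactZeros w k z := by
  obtain ⟨w, v, J, hF⟩ := exists_profile_family (n := n) (by omega) hp
  have hn1 : 1 ≤ n := by omega
  set A : Set ℝ := {c | c ∈ Ioo (0:ℝ) 1 ∧ ¬HasZeros (w c) (k + 1)} with hA
  have hAbdd : BddBelow A := ⟨0, fun c hc => hc.1.1.le⟩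
  have hp0 : 0 < p + 1 := by linarith
  obtain ⟨d, hd1, hd2⟩ := exists_between (show 2 / (p + 1) < 1 by
    rw [div_lt_one hp0]; linarith)
  have hd0 : 0 < d := lt_trans (by positivity) hd1
  have hdA : d ∈ A := by
    refine ⟨⟨hd0, hd2⟩, fun ⟨z, _, hz⟩ => ?_⟩
    have hP := hF.isProfile d ⟨hd0.le, hd2⟩
    have := hP.energy_pos_of_w_eq_zero hn1 hp ⟨hd0.le, hd2⟩ le_rfl (hz 0).1.le (hz 0).1 (hz 0).2
    rw [hP.energy_zero] at this
    have e : 2 / (p + 1) = 2 * (1 / (p + 1)) := by ring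
    linarith
  set c := sInf A with hc
  have hc0 : 0 < c := by
    have h0 : (0:ℝ) ∈ Ico (0:ℝ) 1 := ⟨le_rfl, one_pos⟩
    have := hF.eventually_hasZeros hn1 hp h0 (hasZeros_of_forall_exists_gt
      (fun R => (hF.isProfile 0 h0).exists_zero_gt hn hp hp' R) (k + 1))
    obtain ⟨ε, hε, hsub⟩ := Metric.eventually_nhds_iff.1 (eventually_nhdsWithin_iff.1 this)
    refine hε.trans_le (le_csInf ⟨d, hdA⟩ fun x hx => ?_)
    by_contra! hlt
    exact hx.2 (hsub (by rwa [Real.dist_eq, sub_zero, abs_of_pos hx.1.1]) ⟨hx.1.1.le, hx.1.2⟩)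
  have hcI : c ∈ Ioo (0:ℝ) 1 := ⟨hc0, (csInf_le hAbdd hdA).trans_lt hd2⟩
  have hcI' : c ∈ Ico (0:ℝ) 1 := ⟨hc0.le, hcI.2⟩
  have hP := hF.isProfile c hcI'
  have hnot : ¬HasZeros (w c) (k + 1) := fun hcon => by
    have h1 := eventually_nhdsWithin_iff.1 (hF.eventually_hasZeros hn1 hp hcI' hcon)
    obtain ⟨x, hxA, hx⟩ := ((mem_closure_iff_frequently.1
      (csInf_mem_closure ⟨d, hdA⟩ hAbdd)).and_eventually h1).exists
    exact hxA.2 (hx ⟨hxA.1.1.le, hxA.1.2⟩)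
  have hmin : ¬∀ᶠ x in nhdsWithin c (Ico 0 1), ¬HasZeros (w x) (k + 1) := fun hcon => by
    have h1 := eventually_nhdsWithin_iff.1 hcon
    obtain ⟨x, hx, hxI⟩ := ((h1.filter_mono nhdsWithin_le_nhds).and
      (Ioo_mem_nhdsLT hc0)).exists
    exact absurd (csInf_le hAbdd ⟨⟨hxI.1, hxI.2.trans hcI.2⟩, hx ⟨hxI.1.le, hxI.2.trans hcI.2⟩⟩)
      (not_le.2 hxI.2)
  have hE : ∀ r, 0 ≤ r → 0 ≤ energy p c (w c) (v c) r := by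
    intro r hr
    by_contra! hneg
    refine hmin ?_
    filter_upwards [self_mem_nhdsWithin, (hF.tendsto_energy hp hcI' hr).eventually_lt_const hneg,
      hF.eventually_not_exists_zeros hn1 hp hcI' (m := k + 1) (R := r)
        fun ⟨z, hz1, hz2⟩ => hnot ⟨z, hz1, fun i => ⟨(hz2 i).1.1, (hz2 i).2⟩⟩] with x hx hx1 hx2
    rintro ⟨z, hz1, hz2⟩
    refine hx2 ⟨z, hz1, fun i => ⟨⟨(hz2 i).1, ?_⟩, (hz2 i).2⟩⟩
    by_contra! hlt
    exact absurd ((hF.isProfile x hx).energy_pos_of_w_eq_zero hn1 hp hx hr hlt.le (hz2 i).1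
      (hz2 i).2) (not_lt.2 hx1.le)
  obtain ⟨R, hR⟩ : ∃ R, ∀ r, R < r → w c r ≠ 0 := by
    by_contra! hcon
    exact hnot (hasZeros_of_forall_exists_gt hcon _)
  obtain ⟨hw, hv⟩ := hP.tendsto_zero hn1 hp hc0 (le_max_right R 0)
    (fun r hr => hR r ((le_max_left _ _).trans_lt hr)) hE
  refine ⟨c, hcI, w c, v c, J c, hP, hw, hv, exists_exactZeros ?_ hnot⟩
  by_contra hcon
  refine hmin ?_
  obtain ⟨m, rfl⟩ : ∃ m, n = m + 1 := ⟨n - 1, by omega⟩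
  obtain ⟨S, hS⟩ := (hF.eventually_eq_of_w_eq_zero (by omega) hp hcI hw).exists
  filter_upwards [hS, hF.eventually_not_exists_zeros hn1 hp hcI' (m := k) (R := S)
    fun ⟨z, hz1, hz2⟩ => hcon ⟨z, hz1, fun i => ⟨(hz2 i).1.1, (hz2 i).2⟩⟩] with x hx1 hx2
  rintro ⟨z, hz1, hz2⟩
  refine hx2 ⟨fun i => z i.castSucc, hz1.comp Fin.strictMono_castSucc,
    fun i => ⟨⟨(hz2 _).1, ?_⟩, (hz2 _).2⟩⟩
  by_contra! hlt
  exact hx1 _ _ hlt (hz1 i.castSucc_lt_last) (hz2 _).2 (hz2 _).2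

/-- Rescaling a profile to a solution of the initial value problem. -/
lemma IsProfile.isSolution {n : ℕ} {p c α t : ℝ} {w v J : ℝ → ℝ} (hp : 1 < p)
    (h : IsProfile n p c w v J) (hα : 0 < α) (ht : 0 < t) (hct : c * t ^ 2 = 1)
    (hαt : α ^ (p - 1) = t ^ 2) :
    IsSolution n p α (fun r => α * w (t * r)) (fun r => α * (t * v (t * r)))
      (fun r => α * (t * (t * (((n : ℝ) - 1) * J (t * r) -
        (oddPow p (w (t * r)) - c * w (t * r)))))) := by
  have hlin : ∀ r : ℝ, HasDerivAt (fun r => t * r) t r := fun r => by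
    simpa using (hasDerivAt_id r).const_mul t
  refine ⟨by simp [h.init], by simp [h.v_zero], fun r hr => ?_, fun r hr => ?_, ?_,
    fun r hr => ?_⟩
  · refine ((((h.deriv_w (t * r)).comp r (hlin r)).const_mul α).congr_deriv ?_).hasDerivWithinAt
    ring
  · have hr : 0 ≤ r := hr
    refine ((((h.hasDerivAt_v (by positivity)).comp r (hlin r)).const_mul t).const_mul
      α).congr_deriv ?_ |>.hasDerivWithinAt
    ring
  · have h1 := h.continuous_w
    have h2 := h.cont_J
    have h3 := continuous_oddPow hp
    fun_prop
  · simp only [h.v_eq (t * r), f, oddPow, abs_mul, abs_of_pos hα,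
      Real.mul_rpow hα.le (abs_nonneg _), hαt]
    field_simp
    linear_combination (α * w (t * r)) * hct

end RadialBoundState

/-- existence of a decaying solution with exactly `k` zeros. -/
theorem statement1 (n : ℕ) (hn : 3 ≤ n) (p : ℝ) (hp1 : 1 < p)
    (hp2 : p < ((n : ℝ) + 2) / ((n : ℝ) - 2)) (k : ℕ) :
    ∃ (α : ℝ) (u u' u'' : ℝ → ℝ) (z : Fin k → ℝ),
      0 < α ∧ IsSolution n p α u u' u'' ∧ Decaying u u' ∧ ExactZeros u k z := by
  obtain ⟨c, hc, w, v, J, hP, hw, hv, z, hz1, hz2, hz3⟩ :=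
    RadialBoundState.exists_profile_exactZeros hn hp1 hp2 k
  have hc0 : 0 < c := hc.1
  set t := (√c)⁻¹ with ht
  have ht0 : 0 < t := by positivity
  have ht2 : t ^ 2 = c⁻¹ := by rw [ht, inv_pow, Real.sq_sqrt hc0.le]
  set α := (t ^ 2) ^ (p - 1)⁻¹ with hα
  have hα0 : 0 < α := by positivity
  have hlim : Tendsto (fun r : ℝ => t * r) atTop atTop := tendsto_id.const_mul_atTop ht0
  refine ⟨α, _, _, _, fun i => z i / t, hα0, hP.isSolution hp1 hα0 ht0
    (by rw [ht2, mul_inv_cancel₀ hc0.ne'])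
    (by rw [hα, Real.rpow_inv_rpow (by positivity) (by linarith)]), ⟨?_, ?_⟩, ?_, ?_, ?_⟩
  · simpa using (hw.comp hlim).const_mul α
  · simpa using ((hv.comp hlim).const_mul t).const_mul α
  · exact fun i j hij => div_lt_div_of_pos_right (hz1 hij) ht0
  · intro i
    refine ⟨div_pos (hz2 i).1 ht0, ?_⟩
    simp only [mul_div_cancel₀ _ ht0.ne', (hz2 i).2, mul_zero]
  · intro r hr hur
    obtain ⟨i, hi⟩ := hz3 (t * r) (mul_pos ht0 hr) ((mul_eq_zero.1 hur).resolve_left hα0.ne')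
    exact ⟨i, by simp only [← hi, mul_div_cancel_left₀ _ ht0.ne']⟩
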